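/- Fourier-transformed form of the pentagon identity: for all real numbers α, γ, one has ∫_ℝ ψ̃_{a₄,c₄}(γ−σ) · ψ̃′_{a₂,c₂}(σ) · ψ̃_{a₀,c₀}(α−σ) dσ = e^{−iπ P_e/(12ħ) − 2πi α γ} · ψ̃_{a₁,c₁}(α) · ψ̃_{a₃,c₃}(γ), where the integral converges absolutely. -/

import Mathlib

open Real MeasureTheory

noncomputable section

/-- `c_𝖻 = i(𝖻 + 𝖻⁻¹)/2`. -/
def cB (bb : ℝ) : ℂ := Complex.I * (bb + bb⁻¹) / 2

/-- The integrand in the definition of Faddeev's quantum dilogarithm. -/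
def phiKer (bb : ℝ) (z w : ℂ) : ℂ :=
  Complex.exp (-2 * Complex.I * z * w) /
    (4 * Complex.sinh (w * bb) * Complex.sinh (w / bb) * w)

/-- Faddeev's quantum dilogarithm on the strip `|Im z| < Im c_𝖻`, defined by the
contour integral over `ℝ + iε` with `ε = π·min(𝖻,𝖻⁻¹)/2`. -/
def PhiS (bb : ℝ) (z : ℂ) : ℂ :=
  Complex.exp (∫ t : ℝ, phiKer bb z (t + Complex.I * (π * min bb bb⁻¹ / 2)))

/-- The factor appearing in the functional equation:
`Φ_𝖻(z) = Efac 𝖻 z · Φ_𝖻(z + i𝖻)`. -/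
def Efac (bb : ℝ) (z : ℂ) : ℂ := 1 + Complex.exp (2 * π * bb * (z + Complex.I * bb / 2))

/-- Number of upward shifts by `i𝖻` needed to bring `z` into the strip. -/
def nUp (bb : ℝ) (z : ℂ) : ℕ := ⌊(-((bb + bb⁻¹) / 2) - z.im) / bb⌋₊ + 1

/-- Number of downward shifts by `i𝖻` needed to bring `z` into the strip. -/
def nDn (bb : ℝ) (z : ℂ) : ℕ := ⌊(z.im - (bb + bb⁻¹) / 2) / bb⌋₊ + 1

/-- Faddeev's quantum dilogarithm `Φ_𝖻`, extended from the strip `|Im z| < Im c_𝖻`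
to all of `ℂ` as a meromorphic function by the functional equation
`Φ_𝖻(z - i𝖻/2) = (1 + e^{2π𝖻z}) Φ_𝖻(z + i𝖻/2)`. -/
def Phi (bb : ℝ) (z : ℂ) : ℂ :=
  if z.im ≤ -((bb + bb⁻¹) / 2) then
    (∏ k ∈ Finset.range (nUp bb z), Efac bb (z + Complex.I * k * bb)) *
      PhiS bb (z + Complex.I * (nUp bb z) * bb)
  else if (bb + bb⁻¹) / 2 ≤ z.im then
    PhiS bb (z - Complex.I * (nDn bb z) * bb) /
      ∏ k ∈ Finset.range (nDn bb z), Efac bb (z - Complex.I * (k + 1) * bb)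
  else PhiS bb z

/-- `ψ_{a,c}(t) = Φ_𝖻(t - 2c_𝖻(a+c))⁻¹ e^{-4πi c_𝖻 a (t - c_𝖻(a+c))} e^{-πi c_𝖻²(4(a-c)+1)/6}`. -/
def psiF (bb a c : ℝ) (t : ℂ) : ℂ :=
  (Phi bb (t - 2 * cB bb * (a + c)))⁻¹ *
    Complex.exp (-4 * π * Complex.I * cB bb * a * (t - cB bb * (a + c))) *
    Complex.exp (-π * Complex.I * (cB bb) ^ 2 * (4 * (a - c) + 1) / 6)

/-- `ψ̄_{a,c}(t) = Φ_𝖻(t + 2c_𝖻(a+c)) e^{-4πi c_𝖻 a (t + c_𝖻(a+c))} e^{πi c_𝖻²(4(a-c)+1)/6}`. -/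
def psiBar (bb a c : ℝ) (t : ℂ) : ℂ :=
  Phi bb (t + 2 * cB bb * (a + c)) *
    Complex.exp (-4 * π * Complex.I * cB bb * a * (t + cB bb * (a + c))) *
    Complex.exp (π * Complex.I * (cB bb) ^ 2 * (4 * (a - c) + 1) / 6)

/-- `ψ̃_{a,c}(s) = ∫_ℝ ψ_{a,c}(t) e^{-2πi s t} dt`. -/
def psiT (bb a c : ℝ) (s : ℝ) : ℂ :=
  ∫ t : ℝ, psiF bb a c t * Complex.exp (-2 * π * Complex.I * s * t)

/-- `ψ̃′_{a,c}(s) = e^{-πi s²} ψ̃_{a,c}(s)`. -/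
def psiT' (bb a c : ℝ) (s : ℝ) : ℂ :=
  Complex.exp (-π * Complex.I * s ^ 2) * psiT bb a c s

/-- `g_{a,c}(s,t) = Σ_{m∈ℤ} ψ̃′_{a,c}(s+m) e^{iπ t (s+2m)}`. -/
def gW (bb a c : ℝ) (s t : ℝ) : ℂ :=
  ∑' m : ℤ, psiT' bb a c (s + m) * Complex.exp (Complex.I * π * t * (s + 2 * m))

open scoped ComplexConjugate

lemma integrable_exp_neg_mul_abs {κ : ℝ} (hκ : 0 < κ) :
    Integrable fun x : ℝ => Real.exp (-κ * |x|) := by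
  have h : IntegrableOn (fun x : ℝ => Real.exp (-κ * |x|)) (Set.Ioi 0) :=
    (exp_neg_integrableOn_Ioi 0 hκ).congr_fun
      (fun x hx => by simp only [abs_of_pos (Set.mem_Ioi.1 hx)]) measurableSet_Ioi
  have h' : IntegrableOn (fun x : ℝ => Real.exp (-κ * |x|)) (Set.Iic 0) := by
    rw [integrableOn_Iic_iff_integrableOn_Iio]
    have := h.comp_neg
    simpa using this
  simpa using h'.union h

lemma integrable_of_norm_le_exp_neg_abs {f : ℝ → ℂ} (hf : Continuous f) {C κ : ℝ} (hκ : 0 < κ)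
    (hb : ∀ x, ‖f x‖ ≤ C * Real.exp (-κ * |x|)) : Integrable f :=
  ((integrable_exp_neg_mul_abs hκ).const_mul C).mono' hf.aestronglyMeasurable
    (Filter.Eventually.of_forall hb)

/-- Cauchy's theorem for two horizontal lines and an exponentially decaying function. -/
lemma integral_horizontal_line_eq {f : ℂ → ℂ} {y₁ y₂ : ℝ} (hy : y₁ ≤ y₂)
    (hf : DifferentiableOn ℂ f {z | y₁ ≤ z.im ∧ z.im ≤ y₂}) {C κ : ℝ} (hκ : 0 < κ)
    (hb : ∀ z : ℂ, y₁ ≤ z.im → z.im ≤ y₂ → ‖f z‖ ≤ C * Real.exp (-κ * |z.re|)) :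
    ∫ x : ℝ, f (x + y₁ * Complex.I) = ∫ x : ℝ, f (x + y₂ * Complex.I) := by
  have hint : ∀ y : ℝ, y₁ ≤ y → y ≤ y₂ → Integrable fun x : ℝ => f (x + y * Complex.I) := by
    intro y h1 h2
    refine integrable_of_norm_le_exp_neg_abs (C := C) (κ := κ) ?_ hκ fun x => ?_
    · exact hf.continuousOn.comp_continuous (by fun_prop) fun x => by simp [h1, h2]
    · simpa using hb (x + y * Complex.I) (by simpa) (by simpa)
  have hcon : ∀ R : ℝ, (∫ x in -R..R, f (x + y₁ * Complex.I)) -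
      (∫ x in -R..R, f (x + y₂ * Complex.I)) =
      Complex.I • (∫ y in y₁..y₂, f (((-R : ℝ) : ℂ) + y * Complex.I)) -
      Complex.I • (∫ y in y₁..y₂, f ((R : ℂ) + y * Complex.I)) := by
    intro R
    have := Complex.integral_boundary_rect_eq_zero_of_differentiableOn f
      (⟨-R, y₁⟩) (⟨R, y₂⟩) (hf.mono ?_)
    · simp only at this
      linear_combination this
    · intro z hz
      rw [Complex.mem_reProdIm, Set.uIcc_of_le hy] at hz
      exact ⟨hz.2.1, hz.2.2⟩
  have hside : ∀ s : ℝ → ℝ, (∀ R, |s R| = |R|) →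
      Filter.Tendsto (fun R : ℝ => Complex.I • (∫ y in y₁..y₂, f ((s R : ℂ) + y * Complex.I)))
        Filter.atTop (nhds 0) := by
    intro s hs
    have hlim : Filter.Tendsto (fun R : ℝ => C * Real.exp (-κ * |R|) * |y₂ - y₁|) Filter.atTop
        (nhds 0) := by
      have : Filter.Tendsto (fun R : ℝ => -κ * |R|) Filter.atTop Filter.atBot :=
        Filter.tendsto_abs_atTop_atTop.const_mul_atTop_of_neg (by linarith)
      simpa using ((Real.tendsto_exp_atBot.comp this).const_mul C).mul_const |y₂ - y₁|
    refine squeeze_zero_norm (fun R => ?_) hlim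
    rw [norm_smul, Complex.norm_I, one_mul]
    refine intervalIntegral.norm_integral_le_of_norm_le_const fun y hyy => ?_
    rw [Set.uIoc_of_le hy] at hyy
    simpa [hs] using hb (s R + y * Complex.I) (by simpa using hyy.1.le) (by simpa using hyy.2)
  have h1 := intervalIntegral_tendsto_integral (hint y₁ le_rfl hy) Filter.tendsto_neg_atTop_atBot
    Filter.tendsto_id
  have h2 := intervalIntegral_tendsto_integral (hint y₂ hy le_rfl) Filter.tendsto_neg_atTop_atBot
    Filter.tendsto_id
  have h3 := (hside (fun R => -R) (by simp)).sub (hside id (by simp))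
  have h4 := tendsto_nhds_unique (h1.sub h2) (h3.congr fun R => (hcon R).symm)
  simpa [sub_eq_zero] using h4

/-- Differentiation under the integral sign for holomorphic integrands. -/
lemma hasDerivAt_integral_of_holomorphic {f : ℂ → ℝ → ℂ} {z₀ : ℂ} {r : ℝ} (hr : 0 < r)
    (hd : ∀ t, DifferentiableOn ℂ (f · t) (Metric.ball z₀ r))
    (hm : ∀ z ∈ Metric.ball z₀ r, AEStronglyMeasurable (f z))
    {g : ℝ → ℝ} (hg : Integrable g) (hb : ∀ z ∈ Metric.ball z₀ r, ∀ t, ‖f z t‖ ≤ g t) :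
    HasDerivAt (fun z => ∫ t, f z t) (∫ t, deriv (f · t) z₀) z₀ := by
  have hz₀ : z₀ ∈ Metric.ball z₀ r := Metric.mem_ball_self hr
  have hda : ∀ t, ∀ z ∈ Metric.ball z₀ r, HasDerivAt (f · t) (deriv (f · t) z) z := fun t z hz =>
    ((hd t).differentiableAt (Metric.isOpen_ball.mem_nhds hz)).hasDerivAt
  have hs : Metric.ball z₀ (r / 2) ∈ nhds z₀ := Metric.ball_mem_nhds _ (by positivity)
  refine (hasDerivAt_integral_of_dominated_loc_of_deriv_le (F := f)
    (F' := fun z t => deriv (f · t) z) (bound := fun t => g t / (r / 4)) hs ?_ ?_ ?_ ?_ ?_ ?_).2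
  · filter_upwards [Metric.ball_mem_nhds z₀ hr] with z hz using hm z hz
  · exact hg.mono' (hm z₀ hz₀) (Filter.Eventually.of_forall (hb z₀ hz₀))
  · have hu : Filter.Tendsto (fun n : ℕ => z₀ + ((r / (n + 2) : ℝ) : ℂ)) Filter.atTop
        (nhdsWithin z₀ {z₀}ᶜ) := by
      refine tendsto_nhdsWithin_iff.2 ⟨?_, Filter.Eventually.of_forall fun n => ?_⟩
      · have h1 : Filter.Tendsto (fun n : ℕ => r / ((n : ℝ) + 2)) Filter.atTop (nhds 0) :=
          (tendsto_const_nhds.div_atTop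
            (Filter.tendsto_atTop_add_const_right _ _ tendsto_natCast_atTop_atTop))
        have h2 := (Complex.continuous_ofReal.tendsto 0).comp h1
        simpa [Function.comp_def] using h2.const_add z₀
      · simp only [Set.mem_compl_iff, Set.mem_singleton_iff, add_eq_left, Complex.ofReal_eq_zero]
        positivity
    refine aestronglyMeasurable_of_tendsto_ae Filter.atTop
      (f := fun (n : ℕ) t => slope (f · t) z₀ (z₀ + ((r / (n + 2) : ℝ) : ℂ))) (fun n => ?_)
      (Filter.Eventually.of_forall fun t =>
        ((hasDerivAt_iff_tendsto_slope.1 (hda t z₀ hz₀)).comp hu))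
    have hmem : z₀ + ((r / (n + 2) : ℝ) : ℂ) ∈ Metric.ball z₀ r := by
      rw [Metric.mem_ball, dist_eq_norm, add_sub_cancel_left, Complex.norm_real,
        Real.norm_of_nonneg (by positivity), div_lt_iff₀ (by positivity)]
      have : (0:ℝ) ≤ n := n.cast_nonneg
      nlinarith
    simp only [slope_def_module]
    exact ((hm _ hmem).sub (hm _ hz₀)).const_smul (_ : ℂ)
  · refine Filter.Eventually.of_forall fun t z hz => ?_
    have hsub : Metric.closedBall z (r / 4) ⊆ Metric.ball z₀ r := fun w hw => by
      have h1 := Metric.mem_ball.1 hz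
      have h2 := Metric.mem_closedBall.1 hw
      have h3 := dist_triangle w z z₀
      rw [Metric.mem_ball]; linarith
    refine Complex.norm_deriv_le_of_forall_mem_sphere_norm_le (by positivity) ?_
      fun w hw => hb w (hsub (Metric.sphere_subset_closedBall hw)) t
    exact ((hd t).mono hsub).diffContOnCl_ball (Set.Subset.refl _)
  · exact hg.div_const _
  · exact Filter.Eventually.of_forall fun t z hz =>
      hda t z (Metric.ball_subset_ball (by linarith) hz)

lemma isOpen_im_strip (y₀ y₁ : ℝ) : IsOpen {z : ℂ | y₀ < z.im ∧ z.im < y₁} :=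
  isOpen_Ioo.preimage Complex.continuous_im

lemma add_int_mul_eq_of_periodic_strip {h : ℂ → ℂ} {b y₀ y₁ : ℝ} (hb : 0 < b)
    (hper : ∀ z : ℂ, y₀ < z.im → z.im + b < y₁ → h (z + b * Complex.I) = h z) (m : ℤ) (z : ℂ)
    (hz : y₀ < z.im ∧ z.im < y₁) (hz' : y₀ < z.im + m * b ∧ z.im + m * b < y₁) :
    h (z + m * b * Complex.I) = h z := by
  have key : ∀ (k : ℕ) (z : ℂ), y₀ < z.im → z.im + k * b < y₁ →
      h (z + k * b * Complex.I) = h z := by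
    intro k
    induction k with
    | zero => intro z _ _; simp
    | succ k ih =>
      intro z h1 h2
      push_cast at h2
      have hk : 0 ≤ (k : ℝ) * b := by positivity
      rw [← ih z h1 (by nlinarith), ← hper (z + k * b * Complex.I) (by simp; linarith)
        (by simp; linarith)]
      congr 1; push_cast; ring
  obtain ⟨k, rfl | rfl⟩ := m.eq_nat_or_neg
  · simpa using key k z hz.1 (by simpa using hz'.2)
  · have := key k (z + ((-k : ℤ) : ℂ) * b * Complex.I) (by simpa using hz'.1)
      (by simpa using hz.2)
    rw [← this]
    congr 1; push_cast; ring

/-- Liouville's theorem for functions on a horizontal strip which are periodic under a vertical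
translation, bounded to the left and growing less than the basic exponential to the right. -/
lemma eq_of_periodic_strip {h : ℂ → ℂ} {b y₀ y₁ θ C : ℝ} (hb : 0 < b) (hw : y₀ + b < y₁)
    (hd : DifferentiableOn ℂ h {z | y₀ < z.im ∧ z.im < y₁})
    (hper : ∀ z : ℂ, y₀ < z.im → z.im + b < y₁ → h (z + b * Complex.I) = h z) (hθ : θ < 1)
    (hleft : ∀ z : ℂ, y₀ < z.im → z.im < y₁ → z.re ≤ 0 → ‖h z‖ ≤ C)
    (hright : ∀ z : ℂ, y₀ < z.im → z.im < y₁ → 0 ≤ z.re →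
      ‖h z‖ ≤ C * Real.exp (2 * π * θ * z.re / b)) :
    ∃ K, ∀ z : ℂ, y₀ < z.im → z.im < y₁ → h z = K := by
  set y₂ := (y₀ + y₁ - b) / 2 with hy₂
  let n : ℂ → ℤ := fun u => toIcoDiv hb y₂ u.re
  have hn : ∀ u, y₂ ≤ u.re - n u * b ∧ u.re - n u * b < y₂ + b := fun u => by
    have := sub_toIcoDiv_zsmul_mem_Ico hb y₂ u.re
    rwa [zsmul_eq_mul] at this
  let f : ℂ → ℂ := fun u => h (Complex.I * (u - n u * b))
  have hf : ∀ (u : ℂ) (m : ℤ), y₀ < u.re - m * b → u.re - m * b < y₁ →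
      f u = h (Complex.I * (u - m * b)) := by
    intro u m h1 h2
    have := hn u
    rw [← add_int_mul_eq_of_periodic_strip hb hper (m - n u) (Complex.I * (u - m * b))
      (by simp; constructor <;> linarith) (by push_cast; simp; constructor <;> linarith)]
    simp only [f]
    congr 1; push_cast; ring
  have hfper : Function.Periodic f (b : ℂ) := by
    intro u
    have := hn u
    rw [hf (u + b) (n u + 1) (by push_cast; simp; linarith) (by push_cast; simp; linarith)]
    simp only [f]
    congr 1; push_cast; ring
  have hfd : ∀ u, DifferentiableAt ℂ f u := by
    intro u
    have h1 := hn u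
    have hev : f =ᶠ[nhds u] fun v => h (Complex.I * (v - n u * b)) := by
      have ho : {v : ℂ | y₀ < v.re - n u * b ∧ v.re - n u * b < y₁} ∈ nhds u := by
        refine IsOpen.mem_nhds ?_ ⟨by linarith, by linarith⟩
        exact isOpen_Ioo.preimage (f := fun v : ℂ => v.re - n u * b) (by fun_prop)
      filter_upwards [ho] with v hv using hf v (n u) hv.1 hv.2
    refine DifferentiableAt.congr_of_eventuallyEq ?_ hev
    have h2 : DifferentiableAt ℂ h (Complex.I * (u - n u * b)) :=
      hd.differentiableAt ((isOpen_im_strip y₀ y₁).mem_nhds (by simp; constructor <;> linarith))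
    exact h2.comp u (by fun_prop)
  have hfl : ∀ u : ℂ, 0 ≤ u.im → ‖f u‖ ≤ C := fun u hu => by
    have := hn u
    exact hleft _ (by simp; linarith) (by simp; linarith) (by simpa using hu)
  have hfr : ∀ u : ℂ, u.im ≤ 0 → ‖f u‖ ≤ C * Real.exp (2 * π * θ * (-u.im) / b) := fun u hu => by
    have := hn u
    simpa using hright (Complex.I * (u - n u * b)) (by simp; linarith) (by simp; linarith)
      (by simpa using hu)
  set J := Function.Periodic.cuspFunction b f with hJ
  have hJq : ∀ u, J (Function.Periodic.qParam b u) = f u :=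
    Function.Periodic.eq_cuspFunction hb.ne' hfper
  have hJd : Differentiable ℂ J := by
    intro w
    by_cases hw0 : w = 0
    · rw [hw0]
      refine Function.Periodic.differentiableAt_cuspFunction_zero hb hfper
        (Filter.Eventually.of_forall hfd) ?_
      refine Asymptotics.IsBigO.of_bound C ?_
      have : ∀ᶠ u : ℂ in Filter.comap Complex.im Filter.atTop, 0 ≤ u.im :=
        Filter.tendsto_comap.eventually (Filter.eventually_ge_atTop 0)
      filter_upwards [this] with u hu
      simpa using hfl u hu
    · rw [← Function.Periodic.qParam_right_inv hb.ne' hw0]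
      exact Function.Periodic.differentiableAt_cuspFunction hb.ne' hfper (hfd _)
  have hJb : ∀ w : ℂ, 1 ≤ ‖w‖ → ‖J w‖ ≤ C * ‖w‖ ^ θ := by
    intro w hw1
    have hw0 : w ≠ 0 := by rintro rfl; simp at hw1; linarith
    have hq := Function.Periodic.qParam_right_inv hb.ne' hw0
    have him := Function.Periodic.im_invQParam b w
    have hlog := Real.log_nonneg hw1
    have h0 : 0 < b / (2 * π) := by positivity
    rw [← hq, hJq, hq]
    refine (hfr _ ?_).trans_eq ?_
    · rw [him]; have := mul_nonneg h0.le hlog; rw [neg_div]; linarith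
    · rw [him, Real.rpow_def_of_pos (by linarith)]
      congr 2
      field_simp
  have hS : Differentiable ℂ (dslope J 0) := by
    rw [← differentiableOn_univ]
    exact (Complex.differentiableOn_dslope Filter.univ_mem).2 hJd.differentiableOn
  have hlim : Filter.Tendsto (dslope J 0) (Filter.cocompact ℂ) (nhds 0) := by
    have h1 : Filter.Tendsto (fun w : ℂ => C * ‖w‖ ^ (-(1 - θ)) + ‖J 0‖ * ‖w‖⁻¹)
        (Filter.cocompact ℂ) (nhds (C * 0 + ‖J 0‖ * 0)) :=
      (((tendsto_rpow_neg_atTop (by linarith)).comp (tendsto_norm_cocompact_atTop)).const_mul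
        C).add ((tendsto_inv_atTop_zero.comp tendsto_norm_cocompact_atTop).const_mul _)
    simp only [mul_zero, add_zero] at h1
    refine squeeze_zero_norm' ?_ h1
    filter_upwards [tendsto_norm_cocompact_atTop.eventually (Filter.eventually_ge_atTop 1)]
      with w hw1
    have hw0 : w ≠ 0 := by rintro rfl; simp at hw1; linarith
    have hpos : 0 < ‖w‖ := by linarith
    rw [dslope_of_ne _ hw0, slope_def_module, norm_smul, sub_zero, norm_inv]
    calc ‖w‖⁻¹ * ‖J w - J 0‖ ≤ ‖w‖⁻¹ * (C * ‖w‖ ^ θ + ‖J 0‖) := by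
          gcongr
          exact (norm_sub_le _ _).trans (by gcongr; exact hJb w hw1)
      _ = _ := by
          rw [neg_sub, Real.rpow_sub_one hpos.ne']
          field_simp
  have hJc : ∀ w, J w = J 0 := by
    intro w
    have h1 := hS.apply_eq_of_tendsto_cocompact w hlim
    have h2 := sub_smul_dslope J 0 w
    rw [h1, smul_zero] at h2
    exact (sub_eq_zero.1 h2.symm)
  refine ⟨J 0, fun z h1 h2 => ?_⟩
  have := hf (-Complex.I * z) 0 (by simpa using h1) (by simpa using h2)
  rw [← hJc (Function.Periodic.qParam b (-Complex.I * z)), hJq, this]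
  congr 1
  push_cast
  linear_combination z * Complex.I_mul_I

lemma sinh_re_add_im (w : ℂ) : Complex.sinh w =
    ((Real.sinh w.re * Real.cos w.im : ℝ) : ℂ) +
      ((Real.cosh w.re * Real.sin w.im : ℝ) : ℂ) * Complex.I := by
  conv_lhs => rw [← Complex.re_add_im w, Complex.sinh_add, Complex.sinh_mul_I, Complex.cosh_mul_I]
  push_cast
  ring

lemma cosh_mul_abs_sin_le_norm_sinh (w : ℂ) :
    Real.cosh w.re * |Real.sin w.im| ≤ ‖Complex.sinh w‖ := by
  calc Real.cosh w.re * |Real.sin w.im| = |(Complex.sinh w).im| := by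
        rw [sinh_re_add_im w, Complex.add_im, Complex.ofReal_im, Complex.im_ofReal_mul,
          Complex.I_im, zero_add, mul_one, abs_mul, abs_of_pos (Real.cosh_pos _)]
    _ ≤ _ := Complex.abs_im_le_norm _

lemma abs_sinh_re_le_norm_sinh (w : ℂ) : |Real.sinh w.re| ≤ ‖Complex.sinh w‖ := by
  refine abs_le_of_sq_le_sq ?_ (norm_nonneg _)
  rw [Complex.sq_norm, sinh_re_add_im w, Complex.normSq_add_mul_I]
  have h3 := Real.cosh_sq w.re
  have h4 := Real.sin_sq_add_cos_sq w.im
  nlinarith [sq_nonneg (Real.sin w.im)]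

lemma exp_abs_le_two_mul_cosh (x : ℝ) : Real.exp |x| ≤ 2 * Real.cosh x := by
  rw [Real.cosh_eq]
  rcases abs_cases x with ⟨h, -⟩ | ⟨h, -⟩ <;> rw [h] <;>
    linarith [Real.exp_pos x, Real.exp_pos (-x)]

lemma mul_exp_abs_le_abs_sinh {x₀ x : ℝ} (hx : x₀ ≤ |x|) :
    (1 - Real.exp (-2 * x₀)) / 2 * Real.exp |x| ≤ |Real.sinh x| := by
  rw [Real.abs_sinh, Real.sinh_eq]
  have h1 : Real.exp (-|x|) ≤ Real.exp (-2 * x₀) * Real.exp |x| := by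
    rw [← Real.exp_add]; apply Real.exp_le_exp.2; linarith
  linarith

/-- An exponential bound outside a bounded part of a closed strip extends to the strip. -/
lemma exists_bound_of_continuousOn_strip {f : ℂ → ℂ} {y₁ y₂ C κ : ℝ}
    (hf : ContinuousOn f {z | y₁ ≤ z.im ∧ z.im ≤ y₂})
    (hb : ∀ z : ℂ, y₁ ≤ z.im → z.im ≤ y₂ → 1 ≤ |z.re| → ‖f z‖ ≤ C * Real.exp (-κ * |z.re|)) :
    ∃ C', ∀ z : ℂ, y₁ ≤ z.im → z.im ≤ y₂ → ‖f z‖ ≤ C' * Real.exp (-κ * |z.re|) := by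
  have hK : IsCompact (Set.Icc (-1 : ℝ) 1 ×ℂ Set.Icc y₁ y₂) := isCompact_Icc.reProdIm isCompact_Icc
  have hc : ContinuousOn (fun z : ℂ => ‖f z‖ * Real.exp (κ * |z.re|))
      (Set.Icc (-1 : ℝ) 1 ×ℂ Set.Icc y₁ y₂) := by
    refine ((hf.mono fun z hz => ?_).norm).mul (Continuous.continuousOn (by fun_prop))
    exact (Complex.mem_reProdIm.1 hz).2
  obtain ⟨M, hM⟩ := hK.bddAbove_image hc
  refine ⟨max C M, fun z h1 h2 => ?_⟩
  rcases le_total 1 |z.re| with h | h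
  · refine (hb z h1 h2 h).trans ?_
    gcongr
    exact le_max_left _ _
  · have h3 : ‖f z‖ * Real.exp (κ * |z.re|) ≤ M :=
      hM ⟨z, Complex.mem_reProdIm.2 ⟨abs_le.1 h, h1, h2⟩, rfl⟩
    calc ‖f z‖ = ‖f z‖ * Real.exp (κ * |z.re|) * Real.exp (-κ * |z.re|) := by
          rw [mul_assoc, ← Real.exp_add]; simp
      _ ≤ _ := by gcongr; exact h3.trans (le_max_right _ _)

/-- The denominator of the integrand `phiKer`. -/
def dilogDen (b : ℝ) (w : ℂ) : ℂ := 4 * Complex.sinh (w * b) * Complex.sinh (w / b) * w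

/-- The parametrisation of the contour `ℝ + iπb/2`. -/
def contourPt (b t : ℝ) : ℂ := t + Complex.I * (π * b / 2)

lemma contourPt_re (b t : ℝ) : (contourPt b t).re = t := by simp [contourPt]

lemma contourPt_im (b t : ℝ) : (contourPt b t).im = π * b / 2 := by simp [contourPt]

lemma continuous_contourPt (b : ℝ) : Continuous (contourPt b) := by
  unfold contourPt; fun_prop

lemma norm_sinh_contourPt_div {b : ℝ} (hb : 0 < b) (t : ℝ) :
    Real.exp (b⁻¹ * |t|) / 2 ≤ ‖Complex.sinh (contourPt b t / b)‖ := by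
  refine le_trans ?_ (cosh_mul_abs_sin_le_norm_sinh _)
  rw [Complex.div_ofReal_re, Complex.div_ofReal_im, contourPt_re, contourPt_im,
    show π * b / 2 / b = π / 2 by field_simp, Real.sin_pi_div_two, abs_one, mul_one]
  have h := exp_abs_le_two_mul_cosh (t / b)
  rw [abs_div, abs_of_pos hb, div_eq_inv_mul] at h
  linarith

lemma sin_pi_mul_sq_half_pos {b : ℝ} (hb : 0 < b) (hb1 : b ≤ 1) : 0 < Real.sin (π * b / 2 * b) := by
  apply Real.sin_pos_of_pos_of_lt_pi
  · positivity
  · have : b * b ≤ 1 := by nlinarith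
    nlinarith [Real.pi_pos]

lemma norm_dilogDen_contourPt {b : ℝ} (hb : 0 < b) (hb1 : b ≤ 1) (t : ℝ) :
    Real.sin (π * b / 2 * b) * (π * b / 2) * Real.exp ((b + b⁻¹) * |t|) ≤
      ‖dilogDen b (contourPt b t)‖ := by
  have hs := sin_pi_mul_sq_half_pos hb hb1
  have h1 := norm_sinh_contourPt_div hb t
  have h2 : Real.sin (π * b / 2 * b) * (Real.exp (b * |t|) / 2) ≤
      ‖Complex.sinh (contourPt b t * b)‖ := by
    refine le_trans ?_ (cosh_mul_abs_sin_le_norm_sinh _)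
    rw [Complex.re_mul_ofReal, Complex.im_mul_ofReal, contourPt_re, contourPt_im, abs_of_pos hs,
      mul_comm]
    have h := exp_abs_le_two_mul_cosh (t * b)
    rw [abs_mul, abs_of_pos hb, mul_comm] at h
    gcongr
    linarith
  have h3 : π * b / 2 ≤ ‖contourPt b t‖ := by
    have := Complex.abs_im_le_norm (contourPt b t)
    rw [contourPt_im] at this
    exact (le_abs_self _).trans this
  rw [dilogDen, norm_mul, norm_mul, norm_mul]
  calc _ = ‖(4 : ℂ)‖ * (Real.sin (π * b / 2 * b) * (Real.exp (b * |t|) / 2)) *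
        (Real.exp (b⁻¹ * |t|) / 2) * (π * b / 2) := by
        rw [add_mul, Real.exp_add]; norm_num; ring
    _ ≤ _ := by gcongr

lemma dilogDen_contourPt_ne_zero {b : ℝ} (hb : 0 < b) (hb1 : b ≤ 1) (t : ℝ) :
    dilogDen b (contourPt b t) ≠ 0 := by
  have hs := sin_pi_mul_sq_half_pos hb hb1
  rw [← norm_pos_iff]
  exact lt_of_lt_of_le (by positivity) (norm_dilogDen_contourPt hb hb1 t)

lemma continuous_dilogDen (b : ℝ) : Continuous (dilogDen b) := by
  unfold dilogDen
  simp only [div_eq_mul_inv]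
  fun_prop

lemma continuous_phiKer_contourPt {b : ℝ} (hb : 0 < b) (hb1 : b ≤ 1) (z : ℂ) :
    Continuous fun t => phiKer b z (contourPt b t) := by
  have h1 := continuous_contourPt b
  have h2 := (continuous_dilogDen b).comp h1
  exact Continuous.div (by fun_prop) h2 (dilogDen_contourPt_ne_zero hb hb1)

lemma norm_exp_contourPt (b : ℝ) (z : ℂ) (t : ℝ) :
    ‖Complex.exp (-2 * Complex.I * z * contourPt b t)‖ =
      Real.exp (π * b * z.re + 2 * z.im * t) := by
  rw [Complex.norm_exp]
  congr 1
  simp [contourPt]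
  ring

/-- The constant in the exponential bound for the integrand. -/
def kerConst (b : ℝ) : ℝ := (Real.sin (π * b / 2 * b) * (π * b / 2))⁻¹

lemma kerConst_pos {b : ℝ} (hb : 0 < b) (hb1 : b ≤ 1) : 0 < kerConst b := by
  have := sin_pi_mul_sq_half_pos hb hb1
  unfold kerConst; positivity

lemma norm_inv_dilogDen_le {b : ℝ} (hb : 0 < b) (hb1 : b ≤ 1) (t : ℝ) :
    ‖dilogDen b (contourPt b t)‖⁻¹ ≤ kerConst b * Real.exp (-(b + b⁻¹) * |t|) := by
  have hs := sin_pi_mul_sq_half_pos hb hb1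
  calc ‖dilogDen b (contourPt b t)‖⁻¹ ≤
        (Real.sin (π * b / 2 * b) * (π * b / 2) * Real.exp ((b + b⁻¹) * |t|))⁻¹ := by
        gcongr; exact norm_dilogDen_contourPt hb hb1 t
    _ = _ := by rw [mul_inv, ← Real.exp_neg, kerConst, neg_mul]

lemma norm_phiKer_le {b : ℝ} (hb : 0 < b) (hb1 : b ≤ 1) (z : ℂ) {x y : ℝ}
    (hx : z.re ≤ x) (hy : |z.im| ≤ y) (t : ℝ) :
    ‖phiKer b z (contourPt b t)‖ ≤
      kerConst b * Real.exp (π * b * x) * Real.exp (-(b + b⁻¹ - 2 * y) * |t|) := by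
  have hk := kerConst_pos hb hb1
  change ‖_ / dilogDen b (contourPt b t)‖ ≤ _
  rw [norm_div, norm_exp_contourPt, div_eq_mul_inv]
  have h2 : π * b * z.re + 2 * z.im * t ≤ π * b * x + 2 * y * |t| := by
    have h3 : z.im * t ≤ y * |t| := (le_abs_self _).trans (by rw [abs_mul]; gcongr)
    have h4 : π * b * z.re ≤ π * b * x := by gcongr
    linarith
  calc _ ≤ Real.exp (π * b * x + 2 * y * |t|) *
        (kerConst b * Real.exp (-(b + b⁻¹) * |t|)) := by
        gcongr; exact norm_inv_dilogDen_le hb hb1 t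
    _ = _ := by
        rw [mul_left_comm, ← Real.exp_add, mul_assoc (kerConst b), ← Real.exp_add]
        congr 2; ring

/-- The logarithm of Faddeev's quantum dilogarithm on the strip. -/
def logPhi (b : ℝ) (z : ℂ) : ℂ := ∫ t : ℝ, phiKer b z (contourPt b t)

lemma PhiS_eq_exp_logPhi {b : ℝ} (hb : 0 < b) (hb1 : b ≤ 1) (z : ℂ) :
    PhiS b z = Complex.exp (logPhi b z) := by
  have : min b b⁻¹ = b := min_eq_left (hb1.trans ((one_le_inv₀ hb).2 hb1))
  rw [PhiS, logPhi, this]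
  rfl

lemma integrable_phiKer {b : ℝ} (hb : 0 < b) (hb1 : b ≤ 1) {z : ℂ}
    (hz : |z.im| < (b + b⁻¹) / 2) : Integrable fun t => phiKer b z (contourPt b t) :=
  integrable_of_norm_le_exp_neg_abs (continuous_phiKer_contourPt hb hb1 z)
    (by linarith) (norm_phiKer_le hb hb1 z le_rfl le_rfl)

lemma differentiableAt_logPhi {b : ℝ} (hb : 0 < b) (hb1 : b ≤ 1) {z : ℂ}
    (hz : |z.im| < (b + b⁻¹) / 2) : DifferentiableAt ℂ (logPhi b) z := by
  set r := ((b + b⁻¹) / 2 - |z.im|) / 2 with hr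
  have hr0 : 0 < r := by rw [hr]; linarith
  have hball : ∀ v ∈ Metric.ball z r, v.re ≤ z.re + r ∧ |v.im| ≤ |z.im| + r := by
    intro v hv
    rw [Metric.mem_ball, dist_eq_norm] at hv
    have h1 := (Complex.abs_re_le_norm (v - z)).trans hv.le
    have h2 := (Complex.abs_im_le_norm (v - z)).trans hv.le
    rw [Complex.sub_re, abs_le] at h1
    rw [Complex.sub_im] at h2
    have h3 := abs_sub_abs_le_abs_sub v.im z.im
    constructor <;> linarith
  refine (hasDerivAt_integral_of_holomorphic hr0 (fun t => ?_) (fun v _ => ?_)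
    (g := fun t => kerConst b * Real.exp (π * b * (z.re + r)) *
      Real.exp (-(b + b⁻¹ - 2 * (|z.im| + r)) * |t|)) ?_ fun v hv t => ?_).differentiableAt
  · unfold phiKer; fun_prop
  · exact (continuous_phiKer_contourPt hb hb1 v).aestronglyMeasurable
  · exact (integrable_exp_neg_mul_abs (by linarith)).const_mul _
  · exact norm_phiKer_le hb hb1 v (hball v hv).1 (hball v hv).2 t

lemma exists_norm_logPhi_le {b : ℝ} (hb : 0 < b) (hb1 : b ≤ 1) {y : ℝ}
    (hy : y < (b + b⁻¹) / 2) :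
    ∃ C, 0 ≤ C ∧ ∀ z : ℂ, |z.im| ≤ y → ‖logPhi b z‖ ≤ C * Real.exp (π * b * z.re) := by
  have hk := kerConst_pos hb hb1
  refine ⟨kerConst b * ∫ t : ℝ, Real.exp (-(b + b⁻¹ - 2 * y) * |t|),
    mul_nonneg hk.le (integral_nonneg fun t => (Real.exp_pos _).le), fun z hz => ?_⟩
  have h := norm_integral_le_of_norm_le
    ((integrable_exp_neg_mul_abs (κ := b + b⁻¹ - 2 * y) (by linarith)).const_mul
      (kerConst b * Real.exp (π * b * z.re)))
    (Filter.Eventually.of_forall (norm_phiKer_le hb hb1 z le_rfl hz))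
  rw [integral_const_mul] at h
  exact h.trans_eq (by ring)

lemma conj_logPhi (b : ℝ) (z : ℂ) :
    (starRingEnd ℂ) (logPhi b z) = - logPhi b ((starRingEnd ℂ) z) := by
  rw [logPhi, ← integral_conj, ← integral_neg_eq_self, logPhi, ← integral_neg]
  congr 1 with t
  have h : (starRingEnd ℂ) (contourPt b (-t)) = -contourPt b t := by
    simp [contourPt, Complex.conj_ofNat]; ring
  simp only [phiKer, map_div₀, map_mul, ← Complex.exp_conj, ← Complex.sinh_conj, h, map_neg,
    Complex.conj_I, Complex.conj_ofReal, map_ofNat]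
  rw [neg_mul (contourPt b t), neg_div, Complex.sinh_neg, Complex.sinh_neg,
    show -2 * -Complex.I * (starRingEnd ℂ) z * -contourPt b t =
      -2 * Complex.I * (starRingEnd ℂ) z * contourPt b t by ring,
    show 4 * -Complex.sinh (contourPt b t * b) * -Complex.sinh (contourPt b t / b) *
      -contourPt b t = -(4 * Complex.sinh (contourPt b t * b) *
        Complex.sinh (contourPt b t / b) * contourPt b t) by ring, div_neg]

lemma contourPt_eq (b t : ℝ) : contourPt b t = t + ((π * b / 2 : ℝ) : ℂ) * Complex.I := by
  rw [contourPt]; push_cast; ring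

lemma integral_inv_cosh_div {b : ℝ} (hb : 0 < b) : ∫ t : ℝ, (Real.cosh (t / b))⁻¹ = π * b := by
  have hint : Integrable fun t : ℝ => (Real.cosh (t / b))⁻¹ := by
    refine ((integrable_exp_neg_mul_abs (inv_pos.2 hb)).const_mul 2).mono'
      (Continuous.aestronglyMeasurable ?_) (Filter.Eventually.of_forall fun t => ?_)
    · exact Continuous.inv₀ (by fun_prop) fun t => (Real.cosh_pos _).ne'
    · have h := exp_abs_le_two_mul_cosh (t / b)
      rw [abs_div, abs_of_pos hb, div_eq_inv_mul] at h
      rw [Real.norm_of_nonneg (inv_nonneg.2 (Real.cosh_pos _).le), neg_mul, Real.exp_neg,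
        inv_le_comm₀ (Real.cosh_pos _) (by positivity), mul_inv, inv_inv]
      linarith
  have hder : ∀ t : ℝ, HasDerivAt (fun t : ℝ => 2 * b * Real.arctan (Real.exp (t / b)))
      (Real.cosh (t / b))⁻¹ t := by
    intro t
    have h1 : HasDerivAt (fun t : ℝ => Real.exp (t / b)) (Real.exp (t / b) * (1 / b)) t :=
      ((hasDerivAt_id t).div_const b).exp
    refine (h1.arctan.const_mul (2 * b)).congr_deriv ?_
    rw [Real.cosh_eq, Real.exp_neg]
    have := Real.exp_pos (t / b)
    field_simp
    ring
  have hbot : Filter.Tendsto (fun t : ℝ => 2 * b * Real.arctan (Real.exp (t / b)))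
      Filter.atBot (nhds (2 * b * 0)) := by
    have h1 : Filter.Tendsto (fun t : ℝ => Real.exp (t / b)) Filter.atBot (nhds 0) :=
      Real.tendsto_exp_atBot.comp (Filter.tendsto_id.atBot_div_const hb)
    have h2 := (Real.continuous_arctan.tendsto 0).comp h1
    rw [Real.arctan_zero] at h2
    exact h2.const_mul _
  have htop : Filter.Tendsto (fun t : ℝ => 2 * b * Real.arctan (Real.exp (t / b)))
      Filter.atTop (nhds (2 * b * (π / 2))) := by
    have h1 : Filter.Tendsto (fun t : ℝ => Real.exp (t / b)) Filter.atTop Filter.atTop :=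
      Real.tendsto_exp_atTop.comp (Filter.tendsto_id.atTop_div_const hb)
    exact (((tendsto_nhds_of_tendsto_nhdsWithin Real.tendsto_arctan_atTop).comp h1)).const_mul _
  rw [integral_of_hasDerivAt_of_tendsto hder hint hbot htop]
  ring

lemma sinh_contourPt_div {b : ℝ} (hb : 0 < b) (t : ℝ) :
    Complex.sinh (contourPt b t / b) = Complex.I * (Real.cosh (t / b) : ℝ) := by
  have hb' : (b : ℂ) ≠ 0 := mod_cast hb.ne'
  have : contourPt b t / b = ((t / b : ℝ) : ℂ) + (π / 2 : ℂ) * Complex.I := by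
    rw [contourPt]; push_cast; field_simp
  rw [this, Complex.sinh_add, Complex.sinh_mul_I, Complex.cosh_mul_I, Complex.sin_pi_div_two,
    Complex.cos_pi_div_two]
  push_cast
  ring

/-- The Fourier-type integral which computes the derivative of the difference quotient of
`logPhi`. -/
def sinhInt (b : ℝ) (z : ℂ) : ℂ :=
  ∫ t : ℝ, Complex.exp (-2 * Complex.I * z * contourPt b t) / Complex.sinh (contourPt b t / b)

lemma norm_sinhInt_integrand_le {b : ℝ} (hb : 0 < b) (z : ℂ) {x y : ℝ}
    (hx : z.re ≤ x) (hy : |z.im| ≤ y) (t : ℝ) :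
    ‖Complex.exp (-2 * Complex.I * z * contourPt b t) / Complex.sinh (contourPt b t / b)‖ ≤
      2 * Real.exp (π * b * x) * Real.exp (-(b⁻¹ - 2 * y) * |t|) := by
  rw [norm_div, norm_exp_contourPt]
  have h1 := norm_sinh_contourPt_div hb t
  have h2 : π * b * z.re + 2 * z.im * t ≤ π * b * x + 2 * y * |t| := by
    have h3 : z.im * t ≤ y * |t| := (le_abs_self _).trans (by rw [abs_mul]; gcongr)
    have h4 : π * b * z.re ≤ π * b * x := by gcongr
    linarith
  calc _ ≤ Real.exp (π * b * x + 2 * y * |t|) / (Real.exp (b⁻¹ * |t|) / 2) := by gcongr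
    _ = _ := by
      rw [mul_assoc 2 (Real.exp _), ← Real.exp_add, div_div_eq_mul_div, mul_comm, mul_div_assoc,
        ← Real.exp_sub]
      congr 2; ring

lemma sinh_contourPt_div_ne_zero {b : ℝ} (hb : 0 < b) (t : ℝ) :
    Complex.sinh (contourPt b t / b) ≠ 0 := by
  rw [← norm_pos_iff]
  exact lt_of_lt_of_le (by positivity) (norm_sinh_contourPt_div hb t)

lemma continuous_sinhInt_integrand {b : ℝ} (hb : 0 < b) (z : ℂ) : Continuous fun t =>
    Complex.exp (-2 * Complex.I * z * contourPt b t) / Complex.sinh (contourPt b t / b) := by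
  have h1 := continuous_contourPt b
  refine Continuous.div (by fun_prop) ?_ (sinh_contourPt_div_ne_zero hb)
  simp only [div_eq_mul_inv]
  fun_prop

lemma integrable_sinhInt_integrand {b : ℝ} (hb : 0 < b) {z : ℂ} (hz : |z.im| < b⁻¹ / 2) :
    Integrable fun t =>
      Complex.exp (-2 * Complex.I * z * contourPt b t) / Complex.sinh (contourPt b t / b) :=
  integrable_of_norm_le_exp_neg_abs (continuous_sinhInt_integrand hb z)
    (by linarith) (norm_sinhInt_integrand_le hb z le_rfl le_rfl)

lemma sinhInt_zero {b : ℝ} (hb : 0 < b) : sinhInt b 0 = -Complex.I * (π * b) := by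
  have : ∀ t : ℝ, Complex.exp (-2 * Complex.I * 0 * contourPt b t) /
      Complex.sinh (contourPt b t / b) = -Complex.I * (((Real.cosh (t / b))⁻¹ : ℝ) : ℂ) := by
    intro t
    rw [sinh_contourPt_div hb, mul_zero, zero_mul, Complex.exp_zero, one_div, mul_inv,
      Complex.inv_I, Complex.ofReal_inv]
  rw [sinhInt]
  simp_rw [this]
  rw [integral_const_mul, integral_complex_ofReal, integral_inv_cosh_div hb]
  push_cast; ring

lemma sinhInt_mul_one_add_exp {b : ℝ} (hb : 0 < b) {z : ℂ} (hz : |z.im| < b⁻¹ / 2) :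
    sinhInt b z * (1 + Complex.exp (2 * π * b * z)) =
      2 * Complex.exp (2 * π * b * z) * sinhInt b 0 := by
  have hb' : (b : ℂ) ≠ 0 := mod_cast hb.ne'
  set E := Complex.exp (2 * π * b * z) with hE
  set c : ℂ := Complex.I * (π * b) with hc
  let N : ℂ → ℂ := fun w => Complex.exp (-2 * Complex.I * z * w) - E
  let D : ℂ → ℂ := fun w => Complex.sinh (w / b)
  have hNd : Differentiable ℂ N := by unfold N; fun_prop
  have hDd : Differentiable ℂ D := by unfold D; simp only [div_eq_mul_inv]; fun_prop
  have hNc : N c = 0 := by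
    simp only [N, hc, hE]
    rw [show -2 * Complex.I * z * (Complex.I * (π * b)) = 2 * π * b * z by
      linear_combination (-2 * z * π * b) * Complex.I_mul_I, sub_self]
  have hcb : c / b = π * Complex.I := by rw [hc]; field_simp
  have hDc : D c = 0 := by
    simp only [D]; rw [hcb, Complex.sinh_mul_I, Complex.sin_pi, zero_mul]
  have hDne : ∀ w : ℂ, π * b / 2 ≤ w.im → w.im ≤ 3 * π * b / 2 → w ≠ c → D w ≠ 0 := by
    intro w h1 h2 hwc h0
    apply hwc
    have h3 := abs_sinh_re_le_norm_sinh (w / b)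
    have h4 := cosh_mul_abs_sin_le_norm_sinh (w / b)
    simp only [D] at h0
    rw [h0, norm_zero, Complex.div_ofReal_re] at h3
    rw [h0, norm_zero, Complex.div_ofReal_re, Complex.div_ofReal_im] at h4
    have h5 : w.re = 0 := by
      have := Real.sinh_eq_zero.1 (abs_eq_zero.1 (le_antisymm h3 (abs_nonneg _)))
      rcases div_eq_zero_iff.1 this with h | h
      · exact h
      · exact absurd h hb.ne'
    have h6 : Real.sin (w.im / b - π) = 0 := by
      rw [Real.sin_sub_pi, neg_eq_zero, ← abs_eq_zero]
      have := Real.cosh_pos (w.re / b)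
      exact le_antisymm (by nlinarith [abs_nonneg (Real.sin (w.im / b))]) (abs_nonneg _)
    have h7 : π / 2 ≤ w.im / b := by rw [le_div_iff₀ hb]; linarith
    have h8 : w.im / b ≤ 3 * π / 2 := by rw [div_le_iff₀ hb]; linarith
    have h9 := (Real.sin_eq_zero_iff_of_lt_of_lt (by linarith [Real.pi_pos])
      (by linarith [Real.pi_pos])).1 h6
    have h10 : w.im = π * b := by field_simp at h9; linarith
    apply Complex.ext <;> simp [hc, h5, h10]
  have hDslope : ∀ w : ℂ, π * b / 2 ≤ w.im → w.im ≤ 3 * π * b / 2 → dslope D c w ≠ 0 := by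
    intro w h1 h2
    by_cases hwc : w = c
    · rw [hwc, dslope_same]
      have : HasDerivAt D (Complex.cosh (c / b) * (1 / b)) c :=
        ((hasDerivAt_id c).div_const (b : ℂ)).csinh
      rw [this.deriv, hcb, Complex.cosh_mul_I, Complex.cos_pi]
      simp [hb.ne']
    · rw [dslope_of_ne _ hwc, slope_def_field, hDc, sub_zero]
      exact div_ne_zero (hDne w h1 h2 hwc) (sub_ne_zero.2 hwc)
  let f : ℂ → ℂ := fun w => dslope N c w / dslope D c w
  have hfeq : ∀ w, w ≠ c → f w = N w / D w := by
    intro w hwc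
    have := sub_ne_zero.2 hwc
    simp only [f]
    rw [dslope_of_ne _ hwc, dslope_of_ne _ hwc, slope_def_field, slope_def_field, hDc, hNc,
      sub_zero, sub_zero]
    field_simp
  have hfd : DifferentiableOn ℂ f {w | π * b / 2 ≤ w.im ∧ w.im ≤ 3 * π * b / 2} := by
    have h1 := ((Complex.differentiableOn_dslope (c := c) Filter.univ_mem).2
      hNd.differentiableOn)
    have h2 := ((Complex.differentiableOn_dslope (c := c) Filter.univ_mem).2
      hDd.differentiableOn)
    exact (h1.mono (Set.subset_univ _)).div (h2.mono (Set.subset_univ _))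
      fun w hw => hDslope w hw.1 hw.2
  have hbd : ∀ w : ℂ, π * b / 2 ≤ w.im → w.im ≤ 3 * π * b / 2 → 1 ≤ |w.re| →
      ‖f w‖ ≤ (Real.exp (3 * π * b * |z.re|) + ‖E‖) / ((1 - Real.exp (-2 * b⁻¹)) / 2) *
        Real.exp (-(b⁻¹ - 2 * |z.im|) * |w.re|) := by
    intro w h1 h2 h3
    have hwc : w ≠ c := by
      rintro rfl
      simp [hc] at h3
      linarith
    rw [hfeq w hwc, norm_div]
    have hN : ‖N w‖ ≤ (Real.exp (3 * π * b * |z.re|) + ‖E‖) *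
        Real.exp (2 * |z.im| * |w.re|) := by
      have h4 : ‖Complex.exp (-2 * Complex.I * z * w)‖ ≤
          Real.exp (3 * π * b * |z.re|) * Real.exp (2 * |z.im| * |w.re|) := by
        rw [Complex.norm_exp, ← Real.exp_add]
        apply Real.exp_le_exp.2
        have h5 : z.re * w.im ≤ |z.re| * (3 * π * b / 2) := by
          have h0 : 0 ≤ w.im := le_trans (by positivity) h1
          calc z.re * w.im ≤ |z.re| * w.im := by gcongr; exact le_abs_self _
            _ ≤ _ := by gcongr
        have h6 : z.im * w.re ≤ |z.im| * |w.re| := by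
          rw [← abs_mul]; exact le_abs_self _
        simp
        linarith
      have h5 : 1 ≤ Real.exp (2 * |z.im| * |w.re|) := Real.one_le_exp (by positivity)
      calc ‖N w‖ ≤ _ := norm_sub_le _ _
        _ ≤ Real.exp (3 * π * b * |z.re|) * Real.exp (2 * |z.im| * |w.re|) + ‖E‖ * 1 := by
            rw [mul_one]; gcongr
        _ ≤ Real.exp (3 * π * b * |z.re|) * Real.exp (2 * |z.im| * |w.re|) +
              ‖E‖ * Real.exp (2 * |z.im| * |w.re|) := by gcongr
        _ = _ := by ring
    have hD : (1 - Real.exp (-2 * b⁻¹)) / 2 * Real.exp (b⁻¹ * |w.re|) ≤ ‖D w‖ := by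
      refine le_trans ?_ (abs_sinh_re_le_norm_sinh _)
      rw [Complex.div_ofReal_re]
      have h4 : |w.re / b| = b⁻¹ * |w.re| := by rw [abs_div, abs_of_pos hb, div_eq_inv_mul]
      rw [← h4]
      apply mul_exp_abs_le_abs_sinh
      rw [h4]
      have := inv_pos.2 hb
      nlinarith
    have hpos : 0 < (1 - Real.exp (-2 * b⁻¹)) / 2 := by
      have := inv_pos.2 hb
      have : Real.exp (-2 * b⁻¹) < 1 := Real.exp_lt_one_iff.2 (by linarith)
      linarith
    calc ‖N w‖ / ‖D w‖ ≤ (Real.exp (3 * π * b * |z.re|) + ‖E‖) *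
        Real.exp (2 * |z.im| * |w.re|) /
          ((1 - Real.exp (-2 * b⁻¹)) / 2 * Real.exp (b⁻¹ * |w.re|)) := by gcongr
      _ = _ := by
        rw [mul_div_mul_comm, ← Real.exp_sub]
        congr 2; ring
  obtain ⟨C', hC'⟩ := exists_bound_of_continuousOn_strip hfd.continuousOn hbd
  have key := integral_horizontal_line_eq (y₁ := π * b / 2) (y₂ := 3 * π * b / 2)
    (by nlinarith [mul_pos Real.pi_pos hb]) hfd
    (by linarith) hC'
  have hpos : 0 < π * b := by positivity
  have hi0 := integrable_sinhInt_integrand hb (z := 0) (by simpa using hb)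
  have hiz := integrable_sinhInt_integrand hb hz
  have hl : ∀ x : ℝ, f (x + ((π * b / 2 : ℝ) : ℂ) * Complex.I) =
      Complex.exp (-2 * Complex.I * z * contourPt b x) / Complex.sinh (contourPt b x / b) -
      E * (Complex.exp (-2 * Complex.I * 0 * contourPt b x) /
        Complex.sinh (contourPt b x / b)) := by
    intro x
    rw [← contourPt_eq, hfeq]
    · simp only [N, D]
      rw [sub_div, mul_zero, zero_mul, Complex.exp_zero, mul_one_div]
    · intro h
      have := congrArg Complex.im h
      rw [contourPt_im] at this
      simp [hc] at this
      linarith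
  have hr : ∀ x : ℝ, f (x + ((3 * π * b / 2 : ℝ) : ℂ) * Complex.I) =
      E * (Complex.exp (-2 * Complex.I * 0 * contourPt b x) /
        Complex.sinh (contourPt b x / b)) -
      E * (Complex.exp (-2 * Complex.I * z * contourPt b x) /
        Complex.sinh (contourPt b x / b)) := by
    intro x
    have h1 : (x : ℂ) + ((3 * π * b / 2 : ℝ) : ℂ) * Complex.I = contourPt b x + c := by
      rw [contourPt, hc]; push_cast; ring
    rw [h1, hfeq]
    · simp only [N, D]
      rw [add_div, hcb, Complex.sinh_add, Complex.sinh_mul_I, Complex.cosh_mul_I, Complex.sin_pi,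
        Complex.cos_pi, mul_zero (-2 * Complex.I), zero_mul (contourPt b x), Complex.exp_zero,
        show -2 * Complex.I * z * (contourPt b x + c) =
          -2 * Complex.I * z * contourPt b x + 2 * π * b * z by
          rw [hc]; linear_combination (-2 * z * π * b) * Complex.I_mul_I, Complex.exp_add, ← hE]
      rw [zero_mul, mul_zero, add_zero, mul_neg_one, div_neg]
      ring
    · intro h
      have := congrArg Complex.im h
      rw [Complex.add_im, contourPt_im] at this
      linarith
  simp_rw [hl, hr] at key
  rw [integral_sub hiz (hi0.const_mul _), integral_sub (hi0.const_mul _) (hiz.const_mul _),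
    integral_const_mul, integral_const_mul] at key
  simp only [sinhInt]
  linear_combination key

lemma half_le_norm_contourPt {b : ℝ} (t : ℝ) : π * b / 2 ≤ ‖contourPt b t‖ := by
  have := Complex.abs_im_le_norm (contourPt b t)
  rw [contourPt_im] at this
  exact (le_abs_self _).trans this

lemma logPhi_sub_logPhi {b : ℝ} (hb : 0 < b) (hb1 : b ≤ 1) {z : ℂ} (hz : |z.im| < b⁻¹ / 2) :
    logPhi b (z - Complex.I * b / 2) - logPhi b (z + Complex.I * b / 2) =
      ∫ t : ℝ, -(1 / (2 * contourPt b t)) * (Complex.exp (-2 * Complex.I * z * contourPt b t) /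
        Complex.sinh (contourPt b t / b)) := by
  rw [abs_lt] at hz
  rw [logPhi, logPhi, ← integral_sub (integrable_phiKer hb hb1 _) (integrable_phiKer hb hb1 _)]
  · congr 1 with t
    have hd := dilogDen_contourPt_ne_zero hb hb1 t
    unfold dilogDen at hd
    simp only [mul_ne_zero_iff] at hd
    obtain ⟨⟨⟨-, h1⟩, h2⟩, h3⟩ := hd
    set w := contourPt b t
    simp only [phiKer]
    rw [← sub_div, show -2 * Complex.I * (z - Complex.I * b / 2) * w =
        -2 * Complex.I * z * w + -(w * b) by linear_combination (w * b) * Complex.I_mul_I,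
      show -2 * Complex.I * (z + Complex.I * b / 2) * w =
        -2 * Complex.I * z * w + w * b by linear_combination (-(w * b)) * Complex.I_mul_I,
      Complex.exp_add, Complex.exp_add, ← mul_sub]
    have h4 : Complex.exp (-(w * b)) - Complex.exp (w * b) = -2 * Complex.sinh (w * b) := by
      rw [Complex.sinh]; ring
    rw [h4]
    generalize Complex.sinh (w * b) = S at h1 ⊢
    generalize Complex.sinh (w / b) = S' at h2 ⊢
    field_simp
    ring
  · rw [abs_lt]; simp; constructor <;> linarith
  · rw [abs_lt]; simp; constructor <;> linarith

lemma hasDerivAt_logPhi_sub_logPhi {b : ℝ} (hb : 0 < b) (hb1 : b ≤ 1) {z : ℂ}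
    (hz : |z.im| < b⁻¹ / 2) :
    HasDerivAt (fun z => logPhi b (z - Complex.I * b / 2) - logPhi b (z + Complex.I * b / 2))
      (Complex.I * sinhInt b z) z := by
  set r := (b⁻¹ / 2 - |z.im|) / 2 with hr
  have hr0 : 0 < r := by rw [hr]; linarith
  have hball : ∀ v ∈ Metric.ball z r, v.re ≤ z.re + r ∧ |v.im| ≤ |z.im| + r := by
    intro v hv
    rw [Metric.mem_ball, dist_eq_norm] at hv
    have h1 := (Complex.abs_re_le_norm (v - z)).trans hv.le
    have h2 := (Complex.abs_im_le_norm (v - z)).trans hv.le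
    rw [Complex.sub_re, abs_le] at h1
    rw [Complex.sub_im] at h2
    have h3 := abs_sub_abs_le_abs_sub v.im z.im
    constructor <;> linarith
  have hcont : ∀ v : ℂ, Continuous fun t => -(1 / (2 * contourPt b t)) *
      (Complex.exp (-2 * Complex.I * v * contourPt b t) / Complex.sinh (contourPt b t / b)) := by
    intro v
    have h1 := continuous_contourPt b
    refine Continuous.mul (Continuous.neg (Continuous.div (by fun_prop) (by fun_prop) fun t => ?_))
      (continuous_sinhInt_integrand hb v)
    have h2 := half_le_norm_contourPt (b := b) t
    have h3 : 0 < ‖contourPt b t‖ := lt_of_lt_of_le (by positivity) h2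
    simpa using norm_pos_iff.1 h3
  have key := hasDerivAt_integral_of_holomorphic (z₀ := z) hr0
    (f := fun v t => -(1 / (2 * contourPt b t)) *
      (Complex.exp (-2 * Complex.I * v * contourPt b t) / Complex.sinh (contourPt b t / b)))
    (fun t => by simp only [div_eq_mul_inv]; fun_prop)
    (fun v _ => (hcont v).aestronglyMeasurable)
    (g := fun t => 1 / (π * b) * (2 * Real.exp (π * b * (z.re + r)) *
      Real.exp (-(b⁻¹ - 2 * (|z.im| + r)) * |t|)))
    (((integrable_exp_neg_mul_abs (by linarith)).const_mul _).const_mul _) fun v hv t => ?_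
  · have hev : (fun z => logPhi b (z - Complex.I * b / 2) - logPhi b (z + Complex.I * b / 2))
        =ᶠ[nhds z] fun v => ∫ t : ℝ, -(1 / (2 * contourPt b t)) *
      (Complex.exp (-2 * Complex.I * v * contourPt b t) / Complex.sinh (contourPt b t / b)) := by
      filter_upwards [Metric.ball_mem_nhds z hr0] with v hv
      have := (hball v hv).2
      exact logPhi_sub_logPhi hb hb1 (by linarith)
    refine (key.congr_of_eventuallyEq hev).congr_deriv ?_
    rw [sinhInt, ← integral_const_mul]
    congr 1 with t
    have h3 : contourPt b t ≠ 0 := norm_pos_iff.1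
      (lt_of_lt_of_le (by positivity) (half_le_norm_contourPt (b := b) t))
    have hde : HasDerivAt (fun v : ℂ => Complex.exp (-2 * Complex.I * v * contourPt b t))
        (Complex.exp (-2 * Complex.I * z * contourPt b t) *
          (-2 * Complex.I * 1 * contourPt b t)) z :=
      (((hasDerivAt_id z).const_mul (-2 * Complex.I)).mul_const (contourPt b t)).cexp
    rw [((hde.div_const _).const_mul _).deriv]
    field_simp
  · rw [norm_mul]
    gcongr
    · rw [norm_neg, norm_div, norm_one, norm_mul, Complex.norm_ofNat]
      have := half_le_norm_contourPt (b := b) t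
      exact one_div_le_one_div_of_le (by positivity) (by linarith)
    · exact norm_sinhInt_integrand_le hb v (hball v hv).1 (hball v hv).2 t

lemma tendsto_logPhi_atBot {b : ℝ} (hb : 0 < b) (hb1 : b ≤ 1) {y : ℝ}
    (hy : |y| < (b + b⁻¹) / 2) :
    Filter.Tendsto (fun x : ℝ => logPhi b (x + y * Complex.I)) Filter.atBot (nhds 0) := by
  obtain ⟨C, -, hC⟩ := exists_norm_logPhi_le hb hb1 hy
  have h1 : Filter.Tendsto (fun x : ℝ => C * Real.exp (π * b * x)) Filter.atBot
      (nhds (C * 0)) :=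
    (Real.tendsto_exp_atBot.comp (Filter.tendsto_id.const_mul_atBot (by positivity))).const_mul C
  rw [mul_zero] at h1
  refine squeeze_zero_norm (fun x => ?_) h1
  simpa using hC (x + y * Complex.I) (by simp)

lemma exp_logPhi_shift {b : ℝ} (hb : 0 < b) (hb1 : b ≤ 1) {z : ℂ} (hz : |z.im| < b⁻¹ / 2) :
    Complex.exp (logPhi b (z - Complex.I * b / 2)) =
      (1 + Complex.exp (2 * π * b * z)) * Complex.exp (logPhi b (z + Complex.I * b / 2)) := by
  set l : ℂ → ℂ := fun z =>
    logPhi b (z - Complex.I * b / 2) - logPhi b (z + Complex.I * b / 2) with hl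
  set y := z.im with hy
  let u : ℝ → ℂ := fun x => Complex.exp (-l (x + y * Complex.I)) *
    (1 + Complex.exp (2 * π * b * (x + y * Complex.I)))
  have hu : ∀ x, HasDerivAt u 0 x := by
    intro x
    have him : |((x : ℂ) + y * Complex.I).im| < b⁻¹ / 2 := by simpa using hz
    have h0 : HasDerivAt (fun x : ℝ => (x : ℂ) + y * Complex.I) 1 x :=
      (Complex.ofRealCLM.hasDerivAt (x := x)).add_const _
    have h1 : HasDerivAt (fun x : ℝ => l (x + y * Complex.I))
        (Complex.I * sinhInt b (x + y * Complex.I) * 1) x :=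
      HasDerivAt.comp (h₂ := l) x (hasDerivAt_logPhi_sub_logPhi hb hb1 him) h0
    have h2 := h1.neg.cexp.mul ((h0.const_mul (2 * π * b : ℂ)).cexp.const_add 1)
    refine h2.congr_deriv ?_
    have h3 := sinhInt_mul_one_add_exp hb him
    rw [sinhInt_zero hb] at h3
    simp only [Pi.neg_apply]
    set S := sinhInt b (x + y * Complex.I)
    set E := Complex.exp (2 * π * b * (x + y * Complex.I))
    linear_combination (-(Complex.I * Complex.exp (-l (x + y * Complex.I)))) * h3 +
      2 * E * π * b * Complex.exp (-l (x + y * Complex.I)) * Complex.I_mul_I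
  have hconst : ∀ x x', u x = u x' :=
    is_const_of_deriv_eq_zero (fun x => (hu x).differentiableAt) fun x => (hu x).deriv
  have hlim : Filter.Tendsto u Filter.atBot (nhds 1) := by
    have hz' := abs_lt.1 hz
    have h1 := tendsto_logPhi_atBot hb hb1 (y := y - b / 2)
      (by rw [abs_lt]; constructor <;> linarith)
    have h2 := tendsto_logPhi_atBot hb hb1 (y := y + b / 2)
      (by rw [abs_lt]; constructor <;> linarith)
    have h3 : Filter.Tendsto (fun x : ℝ => l (x + y * Complex.I)) Filter.atBot (nhds (0 - 0)) := by
      refine (h1.sub h2).congr fun x => ?_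
      simp only [hl]
      congr 2 <;> push_cast <;> ring
    have h4 : Filter.Tendsto (fun x : ℝ => Complex.exp (2 * π * b * (x + y * Complex.I)))
        Filter.atBot (nhds 0) := by
      rw [tendsto_zero_iff_norm_tendsto_zero]
      have : ∀ x : ℝ, ‖Complex.exp (2 * π * b * (x + y * Complex.I))‖ =
          Real.exp (2 * π * b * x) := by
        intro x; rw [Complex.norm_exp]; congr 1; simp
      simp_rw [this]
      exact Real.tendsto_exp_atBot.comp (Filter.tendsto_id.const_mul_atBot (by positivity))
    have h5 := ((Complex.continuous_exp.tendsto _).comp h3.neg).mul (h4.const_add 1)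
    simpa [u, Function.comp_def] using h5
  have h1 : u z.re = 1 := by
    have : u = fun _ => u z.re := funext fun x => hconst x _
    rw [this] at hlim
    exact tendsto_nhds_unique tendsto_const_nhds hlim
  simp only [u, hy, Complex.re_add_im, hl] at h1
  rw [neg_sub, Complex.exp_sub] at h1
  have := Complex.exp_ne_zero (logPhi b (z - Complex.I * b / 2))
  rw [div_mul_eq_mul_div, div_eq_one_iff_eq this] at h1
  rw [← h1, mul_comm]

lemma mul_dslope_zero {f : ℂ → ℂ} (hf : f 0 = 0) (w : ℂ) : w * dslope f 0 w = f w := by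
  have := sub_smul_dslope f 0 w
  rwa [hf, sub_zero, sub_zero, smul_eq_mul] at this

lemma differentiable_dslope {f : ℂ → ℂ} (hf : Differentiable ℂ f) (c : ℂ) :
    Differentiable ℂ (dslope f c) := by
  rw [← differentiableOn_univ]
  exact (Complex.differentiableOn_dslope Filter.univ_mem).2 hf.differentiableOn

lemma dslope_sinh_mul_ne_zero {c : ℝ} (hc : 0 < c) {w : ℂ} (hw : |w.im| * c < π) :
    dslope (fun w : ℂ => Complex.sinh (w * c)) 0 w ≠ 0 := by
  by_cases h0 : w = 0
  · have : HasDerivAt (fun w : ℂ => Complex.sinh (w * c)) (Complex.cosh (0 * c) * (1 * c)) 0 :=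
      ((hasDerivAt_id (0 : ℂ)).mul_const (c : ℂ)).csinh
    rw [h0, dslope_same, this.deriv]
    simpa using hc.ne'
  · intro h
    have h1 := mul_dslope_zero (f := fun w : ℂ => Complex.sinh (w * c)) (by simp) w
    rw [h, mul_zero] at h1
    have h3 := abs_sinh_re_le_norm_sinh (w * c)
    have h4 := cosh_mul_abs_sin_le_norm_sinh (w * c)
    rw [← h1, norm_zero, Complex.re_mul_ofReal] at h3
    rw [← h1, norm_zero, Complex.re_mul_ofReal, Complex.im_mul_ofReal] at h4
    have h5 : w.re = 0 := by
      have := Real.sinh_eq_zero.1 (abs_eq_zero.1 (le_antisymm h3 (abs_nonneg _)))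
      simpa [hc.ne'] using this
    have h6 : Real.sin (w.im * c) = 0 := by
      rw [← abs_eq_zero]
      have := Real.cosh_pos (w.re * c)
      exact le_antisymm (by nlinarith [abs_nonneg (Real.sin (w.im * c))]) (abs_nonneg _)
    have h7 : |w.im * c| < π := by rwa [abs_mul, abs_of_pos hc]
    rw [abs_lt] at h7
    have h8 := (Real.sin_eq_zero_iff_of_lt_of_lt h7.1 h7.2).1 h6
    apply h0
    apply Complex.ext
    · simpa using h5
    · simpa [hc.ne'] using h8

lemma norm_sin_sq_le (z w : ℂ) {e : ℝ} (hw : |w.im| ≤ e) :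
    ‖Complex.sin (z * w) ^ 2‖ ≤ Real.exp (2 * e * |z.re|) * Real.exp (2 * |z.im| * |w.re|) := by
  have h1 : ‖Complex.sin (z * w)‖ ≤ Real.exp (e * |z.re| + |z.im| * |w.re|) := by
    have h2 : |(z * w).im| ≤ e * |z.re| + |z.im| * |w.re| := by
      rw [Complex.mul_im]
      refine (abs_add_le _ _).trans ?_
      rw [abs_mul, abs_mul, mul_comm |z.re|]
      gcongr
    have h3 : ‖Complex.exp (-(z * w) * Complex.I)‖ ≤ Real.exp |(z * w).im| := by
      rw [Complex.norm_exp]; apply Real.exp_le_exp.2; simpa using le_abs_self (z * w).im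
    have h4 : ‖Complex.exp ((z * w) * Complex.I)‖ ≤ Real.exp |(z * w).im| := by
      rw [Complex.norm_exp]; apply Real.exp_le_exp.2
      simpa using neg_abs_le (z * w).im |> fun h => neg_le.1 h
    rw [Complex.sin, norm_div, norm_mul, Complex.norm_I, mul_one, Complex.norm_ofNat]
    have h5 := norm_sub_le (Complex.exp (-(z * w) * Complex.I)) (Complex.exp ((z * w) * Complex.I))
    have h6 := Real.exp_le_exp.2 h2
    linarith
  rw [norm_pow]
  calc ‖Complex.sin (z * w)‖ ^ 2 ≤ Real.exp (e * |z.re| + |z.im| * |w.re|) ^ 2 := by gcongr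
    _ = _ := by rw [← Real.exp_nat_mul, ← Real.exp_add]; congr 1; push_cast; ring

lemma integral_sin_sq_sub_eq_zero {b : ℝ} (hb : 0 < b) (hb1 : b ≤ 1) {z : ℂ}
    (hz : |z.im| < (b + b⁻¹) / 2) :
    ∫ t : ℝ, (Complex.sin (z * contourPt b t) ^ 2 - z ^ 2 * Complex.sin (contourPt b t) ^ 2) /
      dilogDen b (contourPt b t) = 0 := by
  have hbi : 0 < b⁻¹ := inv_pos.2 hb
  let s : ℂ → ℂ → ℂ := fun v => dslope (fun w => Complex.sin (v * w)) 0
  let S : ℝ → ℂ → ℂ := fun c => dslope (fun w => Complex.sinh (w * c)) 0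
  have hs : ∀ v w, w * s v w = Complex.sin (v * w) := fun v w => mul_dslope_zero (by simp) w
  have hS : ∀ c w, w * S c w = Complex.sinh (w * c) := fun c w => mul_dslope_zero (by simp) w
  have hs0 : ∀ v, s v 0 = v := by
    intro v
    have : HasDerivAt (fun w => Complex.sin (v * w)) (Complex.cos (v * 0) * (v * 1)) 0 :=
      ((hasDerivAt_id (0 : ℂ)).const_mul v).csin
    simp only [s, dslope_same]
    rw [this.deriv]; simp
  let N : ℂ → ℂ := fun w => s z w ^ 2 - z ^ 2 * s 1 w ^ 2
  have hsd : ∀ v, Differentiable ℂ (s v) := fun v => differentiable_dslope (by fun_prop) 0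
  have hSd : ∀ c, Differentiable ℂ (S c) := fun c => differentiable_dslope (by fun_prop) 0
  have hNd : Differentiable ℂ N := ((hsd z).pow 2).sub (((hsd 1).pow 2).const_mul _)
  have hN0 : N 0 = 0 := by simp only [N, hs0]; ring
  let f : ℂ → ℂ := fun w => dslope N 0 w / (4 * S b w * S b⁻¹ w)
  have hden : ∀ w, dilogDen b w = w ^ 3 * (4 * S b w * S b⁻¹ w) := by
    intro w
    rw [dilogDen, ← hS, div_eq_mul_inv, ← Complex.ofReal_inv, ← hS]
    ring
  have hfeq : ∀ w, w ≠ 0 →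
      f w = (Complex.sin (z * w) ^ 2 - z ^ 2 * Complex.sin w ^ 2) / dilogDen b w := by
    intro w hw
    have h1 : Complex.sin (z * w) ^ 2 - z ^ 2 * Complex.sin w ^ 2 = w ^ 3 * dslope N 0 w := by
      have h2 := mul_dslope_zero hN0 w
      have h3 := hs 1 w
      rw [one_mul] at h3
      rw [← hs, ← h3]
      simp only [N] at h2
      linear_combination -(w ^ 2) * h2
    rw [h1, hden, mul_div_mul_left _ _ (pow_ne_zero 3 hw)]
  have hfd : DifferentiableOn ℂ f {w | -(π * b / 2) ≤ w.im ∧ w.im ≤ π * b / 2} := by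
    refine (differentiable_dslope hNd 0).differentiableOn.div
      (((hSd b).const_mul 4).mul (hSd b⁻¹)).differentiableOn fun w hw => ?_
    have h1 : |w.im| ≤ π * b / 2 := abs_le.2 hw
    refine mul_ne_zero (mul_ne_zero (by norm_num) (dslope_sinh_mul_ne_zero hb ?_))
      (dslope_sinh_mul_ne_zero hbi ?_)
    · calc |w.im| * b ≤ π * b / 2 * b := by gcongr
        _ < π := by
          have : b * b ≤ 1 := by nlinarith
          nlinarith [Real.pi_pos]
    · calc |w.im| * b⁻¹ ≤ π * b / 2 * b⁻¹ := by gcongr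
        _ = π / 2 := by field_simp
        _ < π := by linarith [Real.pi_pos]
  have hbd : ∀ w : ℂ, -(π * b / 2) ≤ w.im → w.im ≤ π * b / 2 → 1 ≤ |w.re| →
      ‖f w‖ ≤ (Real.exp (2 * (π * b / 2) * |z.re|) + ‖z ^ 2‖ * Real.exp (2 * (π * b / 2))) /
        (4 * ((1 - Real.exp (-2 * b)) / 2) * ((1 - Real.exp (-2 * b⁻¹)) / 2)) *
        Real.exp (-(b + b⁻¹ - 2 * |z.im|) * |w.re|) := by
    intro w h1 h2 h3
    have hw : |w.im| ≤ π * b / 2 := abs_le.2 ⟨h1, h2⟩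
    have hw0 : w ≠ 0 := by rintro rfl; simp at h3; linarith
    have hnum : ‖Complex.sin (z * w) ^ 2 - z ^ 2 * Complex.sin w ^ 2‖ ≤
        (Real.exp (2 * (π * b / 2) * |z.re|) + ‖z ^ 2‖ * Real.exp (2 * (π * b / 2))) *
          Real.exp (2 * |z.im| * |w.re|) := by
      have h4 := norm_sin_sq_le z w hw
      have h5 := norm_sin_sq_le 1 w hw
      simp only [one_mul, Complex.one_re, abs_one, mul_one, Complex.one_im, abs_zero, mul_zero,
        zero_mul, Real.exp_zero] at h5
      have h6 : 1 ≤ Real.exp (2 * |z.im| * |w.re|) := Real.one_le_exp (by positivity)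
      calc _ ≤ _ := norm_sub_le _ _
        _ ≤ Real.exp (2 * (π * b / 2) * |z.re|) * Real.exp (2 * |z.im| * |w.re|) +
            ‖z ^ 2‖ * (Real.exp (2 * (π * b / 2)) * 1) := by
            rw [norm_mul, mul_one]; gcongr
        _ ≤ Real.exp (2 * (π * b / 2) * |z.re|) * Real.exp (2 * |z.im| * |w.re|) +
            ‖z ^ 2‖ * (Real.exp (2 * (π * b / 2)) * Real.exp (2 * |z.im| * |w.re|)) := by gcongr
        _ = _ := by ring
    have hsinh : ∀ c : ℝ, 0 < c → (1 - Real.exp (-2 * c)) / 2 * Real.exp (c * |w.re|) ≤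
        ‖Complex.sinh (w * c)‖ := by
      intro c hc
      refine le_trans ?_ (abs_sinh_re_le_norm_sinh _)
      rw [Complex.re_mul_ofReal]
      have h4 : |w.re * c| = c * |w.re| := by rw [abs_mul, abs_of_pos hc, mul_comm]
      rw [← h4]
      apply mul_exp_abs_le_abs_sinh
      rw [h4]; nlinarith
    have hpos : ∀ c : ℝ, 0 < c → 0 < (1 - Real.exp (-2 * c)) / 2 := by
      intro c hc
      have : Real.exp (-2 * c) < 1 := Real.exp_lt_one_iff.2 (by linarith)
      linarith
    have hp1 := hpos b hb
    have hp2 := hpos b⁻¹ hbi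
    have hd : (4 * ((1 - Real.exp (-2 * b)) / 2) * ((1 - Real.exp (-2 * b⁻¹)) / 2)) *
        Real.exp ((b + b⁻¹) * |w.re|) ≤ ‖dilogDen b w‖ := by
      have h4 : 1 ≤ ‖w‖ := h3.trans (Complex.abs_re_le_norm w)
      rw [dilogDen, norm_mul, norm_mul, norm_mul, div_eq_mul_inv w, ← Complex.ofReal_inv,
        Complex.norm_ofNat]
      calc _ = 4 * ((1 - Real.exp (-2 * b)) / 2 * Real.exp (b * |w.re|)) *
            ((1 - Real.exp (-2 * b⁻¹)) / 2 * Real.exp (b⁻¹ * |w.re|)) * 1 := by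
            rw [add_mul, Real.exp_add]; ring
        _ ≤ _ := by
          gcongr
          · exact hsinh b hb
          · exact hsinh b⁻¹ hbi
    rw [hfeq w hw0, norm_div]
    calc _ ≤ (Real.exp (2 * (π * b / 2) * |z.re|) + ‖z ^ 2‖ * Real.exp (2 * (π * b / 2))) *
          Real.exp (2 * |z.im| * |w.re|) /
          ((4 * ((1 - Real.exp (-2 * b)) / 2) * ((1 - Real.exp (-2 * b⁻¹)) / 2)) *
        Real.exp ((b + b⁻¹) * |w.re|)) := by gcongr
      _ = _ := by
        rw [mul_div_mul_comm, ← Real.exp_sub]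
        congr 2; ring
  obtain ⟨C', hC'⟩ := exists_bound_of_continuousOn_strip hfd.continuousOn hbd
  have hpb : 0 < π * b := by positivity
  have key := integral_horizontal_line_eq (y₁ := -(π * b / 2)) (y₂ := π * b / 2)
    (by linarith) hfd (by linarith) hC'
  have hne : ∀ t, contourPt b t ≠ 0 := fun t => norm_pos_iff.1
    (lt_of_lt_of_le (by positivity) (half_le_norm_contourPt (b := b) t))
  have hodd : ∀ w, w ≠ 0 → f (-w) = -f w := by
    intro w hw
    rw [hfeq w hw, hfeq (-w) (neg_ne_zero.2 hw), mul_neg, Complex.sin_neg, Complex.sin_neg,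
      dilogDen, dilogDen, neg_mul w, neg_div, Complex.sinh_neg, Complex.sinh_neg,
      neg_sq, neg_sq, ← div_neg]
    congr 1; ring
  have h1 : ∫ x : ℝ, f (x + ((-(π * b / 2) : ℝ) : ℂ) * Complex.I) =
      -∫ x : ℝ, f (contourPt b x) := by
    rw [← integral_neg_eq_self, ← integral_neg]
    congr 1 with t
    rw [← hodd _ (hne t), contourPt]
    congr 1; push_cast; ring
  simp_rw [← contourPt_eq] at key
  rw [h1] at key
  have h2 : ∫ x : ℝ, f (contourPt b x) = 0 := by linear_combination (-1 / 2 : ℂ) * key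
  rw [← h2]
  congr 1 with t
  rw [hfeq _ (hne t)]

lemma logPhi_add_logPhi_neg_aux {b : ℝ} (hb : 0 < b) (hb1 : b ≤ 1) {z : ℂ}
    (hz : |z.im| < (b + b⁻¹) / 2) :
    logPhi b z + logPhi b (-z) = 2 * logPhi b 0 +
      (logPhi b 1 + logPhi b (-1) - 2 * logPhi b 0) * z ^ 2 := by
  have hq : 0 < (b + b⁻¹) / 2 := by positivity
  have h := integral_sin_sq_sub_eq_zero hb hb1 hz
  have hsin : ∀ v w : ℂ, Complex.sin (v * w) ^ 2 = (2 - Complex.exp (-2 * Complex.I * v * w) -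
      Complex.exp (-2 * Complex.I * (-v) * w)) / 4 := by
    intro v w
    rw [Complex.sin, show -2 * Complex.I * v * w = -(v * w) * Complex.I + -(v * w) * Complex.I by
      ring, show -2 * Complex.I * -v * w = v * w * Complex.I + v * w * Complex.I by ring,
      Complex.exp_add, Complex.exp_add]
    have h1 : Complex.exp (-(v * w) * Complex.I) * Complex.exp (v * w * Complex.I) = 1 := by
      rw [← Complex.exp_add]; simp
    linear_combination (Complex.exp (-(v * w) * Complex.I) - Complex.exp (v * w * Complex.I)) ^ 2 /
      4 * Complex.I_sq + (1 / 2 : ℂ) * h1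
  have hsin1 : ∀ w : ℂ, Complex.sin w ^ 2 = (2 - Complex.exp (-2 * Complex.I * 1 * w) -
      Complex.exp (-2 * Complex.I * (-1) * w)) / 4 := fun w => by
    rw [← hsin 1 w, one_mul]
  have hint : ∀ t : ℝ, (Complex.sin (z * contourPt b t) ^ 2 -
      z ^ 2 * Complex.sin (contourPt b t) ^ 2) / dilogDen b (contourPt b t) =
      (1 / 4 : ℂ) * ((2 - 2 * z ^ 2) * phiKer b 0 (contourPt b t) -
        phiKer b z (contourPt b t) - phiKer b (-z) (contourPt b t) +
        z ^ 2 * phiKer b 1 (contourPt b t) + z ^ 2 * phiKer b (-1) (contourPt b t)) := by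
    intro t
    rw [hsin, hsin1]
    simp only [phiKer, dilogDen, mul_zero, zero_mul, Complex.exp_zero]
    ring
  simp_rw [hint] at h
  have i0 := (integrable_phiKer hb hb1 (z := 0) (by simpa using hq)).const_mul (2 - 2 * z ^ 2)
  have iz := integrable_phiKer hb hb1 hz
  have iz' := integrable_phiKer hb hb1 (z := -z) (by simpa using hz)
  have i1 := (integrable_phiKer hb hb1 (z := 1) (by simpa using hq)).const_mul (z ^ 2)
  have i1' := (integrable_phiKer hb hb1 (z := -1) (by simpa using hq)).const_mul (z ^ 2)
  have j1 : Integrable (fun t : ℝ => (2 - 2 * z ^ 2) * phiKer b 0 (contourPt b t) -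
      phiKer b z (contourPt b t)) := i0.sub iz
  have j2 : Integrable (fun t : ℝ => (2 - 2 * z ^ 2) * phiKer b 0 (contourPt b t) -
      phiKer b z (contourPt b t) - phiKer b (-z) (contourPt b t)) := j1.sub iz'
  have j3 : Integrable (fun t : ℝ => (2 - 2 * z ^ 2) * phiKer b 0 (contourPt b t) -
      phiKer b z (contourPt b t) - phiKer b (-z) (contourPt b t) +
      z ^ 2 * phiKer b 1 (contourPt b t)) := j2.add i1
  rw [integral_const_mul, integral_add j3 i1', integral_add j2 i1, integral_sub j1 iz',
    integral_sub i0 iz, integral_const_mul, integral_const_mul, integral_const_mul] at h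
  simp only [logPhi]
  linear_combination -4 * h

lemma logPhi_add_logPhi_neg {b : ℝ} (hb : 0 < b) (hb1 : b ≤ 1) {z : ℂ}
    (hz : |z.im| < (b + b⁻¹) / 2) :
    logPhi b z + logPhi b (-z) = 2 * logPhi b 0 + Complex.I * π * z ^ 2 := by
  rw [logPhi_add_logPhi_neg_aux hb hb1 hz]
  set β := logPhi b 1 + logPhi b (-1) - 2 * logPhi b 0 with hβ
  have hbi : 0 < b⁻¹ := inv_pos.2 hb
  have key : ∀ x : ℝ, Complex.exp ((-2 * Complex.I * β * b) * x) =
      Complex.exp ((2 * π * b) * x) := by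
    intro x
    have h1 := exp_logPhi_shift hb hb1 (z := (x : ℂ)) (by simpa using hbi)
    have h2 := exp_logPhi_shift hb hb1 (z := -(x : ℂ)) (by simpa using hbi)
    have him : ∀ s : ℝ, |s| = b / 2 → |((x : ℂ) + s * Complex.I).im| < (b + b⁻¹) / 2 := by
      intro s hs; simp [hs]; linarith
    have h3 := logPhi_add_logPhi_neg_aux hb hb1 (him (b / 2) (abs_of_pos (by linarith)))
    have h4 := logPhi_add_logPhi_neg_aux hb hb1
      (him (-(b / 2)) (by rw [abs_neg, abs_of_pos (by linarith)]))
    rw [← hβ] at h3 h4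
    rw [show (x : ℂ) + ((b / 2 : ℝ) : ℂ) * Complex.I = x + Complex.I * b / 2 by push_cast; ring,
      show -((x : ℂ) + Complex.I * b / 2) = -(x : ℂ) - Complex.I * b / 2 by ring] at h3
    rw [show (x : ℂ) + ((-(b / 2) : ℝ) : ℂ) * Complex.I = x - Complex.I * b / 2 by
      push_cast; ring, show -((x : ℂ) - Complex.I * b / 2) = -(x : ℂ) + Complex.I * b / 2 by
      ring] at h4
    have h5 := congrArg Complex.exp h3
    have h6 := congrArg Complex.exp h4
    rw [Complex.exp_add, h2] at h5
    rw [Complex.exp_add, h1] at h6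
    have h7 : Complex.exp (2 * π * b * -(x : ℂ)) = (Complex.exp (2 * π * b * x))⁻¹ := by
      rw [← Complex.exp_neg]; congr 1; ring
    have hE := Complex.exp_ne_zero (2 * π * b * x)
    have hP := Complex.exp_ne_zero (logPhi b (x + Complex.I * b / 2))
    have hM := Complex.exp_ne_zero (logPhi b (-x + Complex.I * b / 2))
    rw [h7] at h5
    have h8 : Complex.exp (2 * logPhi b 0 + β * (x - Complex.I * b / 2) ^ 2) =
        Complex.exp (2 * π * b * x) *
          Complex.exp (2 * logPhi b 0 + β * (x + Complex.I * b / 2) ^ 2) := by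
      rw [← h5, ← h6]
      field_simp
      ring
    rw [show 2 * logPhi b 0 + β * (x - Complex.I * b / 2) ^ 2 =
      (2 * logPhi b 0 + β * (x + Complex.I * b / 2) ^ 2) + (-2 * Complex.I * β * b) * x by ring,
      Complex.exp_add, mul_comm] at h8
    exact mul_right_cancel₀ (Complex.exp_ne_zero _) h8
  have hder : ∀ k : ℂ, HasDerivAt (fun x : ℝ => Complex.exp (k * x)) k 0 := by
    intro k
    have := ((Complex.ofRealCLM.hasDerivAt (x := 0)).const_mul k).cexp
    simpa using this
  have h1 := (hder (-2 * Complex.I * β * b)).unique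
    ((hder (2 * π * b)).congr_of_eventuallyEq (Filter.Eventually.of_forall key))
  have hb' : (b : ℂ) ≠ 0 := mod_cast hb.ne'
  have h2 : β = Complex.I * π := by
    apply mul_right_cancel₀ hb'
    linear_combination (Complex.I / 2) * h1 + β * b * Complex.I_sq
  rw [h2]

/-- The analytic properties of Faddeev's quantum dilogarithm on its strip of holomorphy
`|Im z| < q` used below. -/
structure IsQDilog (b q : ℝ) (F : ℂ → ℂ) (A : ℂ) : Prop where
  b_pos : 0 < b
  b_le_one : b ≤ 1
  two_q : 2 * q = b + b⁻¹
  diff : DifferentiableOn ℂ F {z | -q < z.im ∧ z.im < q}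
  ne_zero : ∀ z, F z ≠ 0
  shift : ∀ z : ℂ, -q < z.im → z.im + b < q →
    F z = (1 + Complex.exp (2 * π * b * (z + b / 2 * Complex.I))) * F (z + b * Complex.I)
  inversion : ∀ z : ℂ, -q < z.im → z.im < q → F z * F (-z) = A * Complex.exp (Complex.I * π * z ^ 2)
  conj_eq : ∀ z : ℂ, F ((starRingEnd ℂ) z) * (starRingEnd ℂ) (F z) = 1
  bound_left : ∀ y < q, ∃ C, ∀ z : ℂ, |z.im| ≤ y → z.re ≤ 0 → ‖F z‖ ≤ C ∧ ‖(F z)⁻¹‖ ≤ C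
  tendsto_left : ∀ y : ℝ, |y| < q →
    Filter.Tendsto (fun x : ℝ => F (x + y * Complex.I)) Filter.atBot (nhds 1)

lemma isQDilog_PhiS {b : ℝ} (hb : 0 < b) (hb1 : b ≤ 1) :
    IsQDilog b ((b + b⁻¹) / 2) (PhiS b) (Complex.exp (2 * logPhi b 0)) := by
  have hP : PhiS b = fun z => Complex.exp (logPhi b z) := funext (PhiS_eq_exp_logPhi hb hb1)
  rw [hP]
  refine ⟨hb, hb1, by ring, fun z hz => ?_, fun z => Complex.exp_ne_zero _, fun z h1 h2 => ?_,
    fun z h1 h2 => ?_, fun z => ?_, fun y hy => ?_, fun y hy => ?_⟩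
  · exact (differentiableAt_logPhi hb hb1 (abs_lt.2 hz)).cexp.differentiableWithinAt
  · have := exp_logPhi_shift hb hb1 (z := z + b / 2 * Complex.I)
      (by rw [abs_lt]; simp; constructor <;> linarith)
    rw [show z + b / 2 * Complex.I - Complex.I * b / 2 = z by ring,
      show z + b / 2 * Complex.I + Complex.I * b / 2 = z + b * Complex.I by ring] at this
    exact this
  · rw [← Complex.exp_add, ← Complex.exp_add, logPhi_add_logPhi_neg hb hb1 (abs_lt.2 ⟨h1, h2⟩)]
  · rw [← Complex.exp_conj, conj_logPhi, ← Complex.exp_add, add_neg_cancel, Complex.exp_zero]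
  · obtain ⟨C, hC0, hC⟩ := exists_norm_logPhi_le hb hb1 hy
    refine ⟨Real.exp C, fun z h1 h2 => ?_⟩
    have h3 : ‖logPhi b z‖ ≤ C := (hC z h1).trans
      (mul_le_of_le_one_right hC0 (Real.exp_le_one_iff.2
        (mul_nonpos_of_nonneg_of_nonpos (by positivity) h2)))
    rw [← Complex.exp_neg]
    refine ⟨(Complex.norm_exp_le_exp_norm _).trans (Real.exp_le_exp.2 h3),
      (Complex.norm_exp_le_exp_norm _).trans (Real.exp_le_exp.2 (by rwa [norm_neg]))⟩
  · have := (Complex.continuous_exp.tendsto _).comp (tendsto_logPhi_atBot hb hb1 hy)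
    simpa [Function.comp_def] using this

lemma PhiS_inv (b : ℝ) : PhiS b⁻¹ = PhiS b := by
  funext z
  simp only [PhiS, phiKer, inv_inv, min_comm b⁻¹ b]
  congr 2 with t
  push_cast
  rw [div_inv_eq_mul, ← div_eq_mul_inv]
  ring_nf

namespace IsQDilog

variable {b q : ℝ} {F : ℂ → ℂ} {A : ℂ}

lemma q_pos (h : IsQDilog b q F A) : 0 < q := by
  have := inv_pos.2 h.b_pos
  linarith [h.two_q, h.b_pos]

lemma b_le_q (h : IsQDilog b q F A) : b ≤ q := by
  have := one_le_inv_iff₀.2 ⟨h.b_pos, h.b_le_one⟩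
  linarith [h.two_q, h.b_le_one]

lemma b_mul_q_le_one (h : IsQDilog b q F A) : b * q ≤ 1 := by
  have h1 : b * (2 * q) = b * b + 1 := by
    rw [h.two_q, mul_add, mul_inv_cancel₀ h.b_pos.ne']
  nlinarith [h.b_pos, h.b_le_one]

lemma A_ne_zero (h : IsQDilog b q F A) : A ≠ 0 := by
  rintro rfl
  have := h.inversion 0 (by simpa using h.q_pos) (by simpa using h.q_pos)
  simp [h.ne_zero] at this

lemma differentiableAt (h : IsQDilog b q F A) {z : ℂ} (h1 : -q < z.im) (h2 : z.im < q) :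
    DifferentiableAt ℂ F z :=
  h.diff.differentiableAt ((isOpen_im_strip _ _).mem_nhds ⟨h1, h2⟩)

lemma bound (h : IsQDilog b q F A) {y : ℝ} (hy : y < q) : ∃ C, 0 < C ∧ ∀ z : ℂ, |z.im| ≤ y →
    ‖F z‖ ≤ C * Real.exp (-2 * π * max z.re 0 * z.im) ∧
    ‖(F z)⁻¹‖ ≤ C * Real.exp (2 * π * max z.re 0 * z.im) := by
  obtain ⟨C, hC⟩ := h.bound_left y hy
  have hA : 0 < ‖A‖ := norm_pos_iff.2 h.A_ne_zero
  refine ⟨max C 0 * (1 + ‖A‖ + ‖A‖⁻¹) + 1, by positivity, fun z hz => ?_⟩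
  have hC1 : ∀ z : ℂ, |z.im| ≤ y → z.re ≤ 0 → ‖F z‖ ≤ max C 0 ∧ ‖(F z)⁻¹‖ ≤ max C 0 :=
    fun z h1 h2 => ⟨(hC z h1 h2).1.trans (le_max_left _ _), (hC z h1 h2).2.trans (le_max_left _ _)⟩
  set D := max C 0 with hD
  have hD0 : 0 ≤ D := le_max_right _ _
  have e0 : D ≤ D * (1 + ‖A‖ + ‖A‖⁻¹) + 1 := by
    have : 0 ≤ D * (‖A‖ + ‖A‖⁻¹) := by positivity
    linarith
  have e1 : ‖A‖ * D ≤ D * (1 + ‖A‖ + ‖A‖⁻¹) + 1 := by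
    have : 0 ≤ D * (1 + ‖A‖⁻¹) := by positivity
    linarith
  have e2 : ‖A‖⁻¹ * D ≤ D * (1 + ‖A‖ + ‖A‖⁻¹) + 1 := by
    have : 0 ≤ D * (1 + ‖A‖) := by positivity
    linarith
  rcases le_total z.re 0 with hr | hr
  · rw [max_eq_right hr]
    simpa using ⟨(hC1 z hz hr).1.trans e0, (by simpa using (hC1 z hz hr).2.trans e0)⟩
  · rw [max_eq_left hr]
    obtain ⟨n1, n2⟩ := hC1 (-z) (by simpa using hz) (by simpa using hr)
    obtain ⟨hl, hu⟩ := abs_lt.1 (hz.trans_lt hy)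
    have hinv := h.inversion z hl hu
    have hF : F z = A * (F (-z))⁻¹ * Complex.exp (Complex.I * π * z ^ 2) := by
      rw [mul_right_comm, ← hinv, mul_inv_cancel_right₀ (h.ne_zero _)]
    have hre : (Complex.I * π * z ^ 2).re = -2 * π * z.re * z.im := by
      simp [sq, Complex.mul_re, Complex.mul_im]; ring
    have hn : ‖F z‖ = ‖A‖ * ‖(F (-z))⁻¹‖ * Real.exp (-2 * π * z.re * z.im) := by
      conv_lhs => rw [hF]
      rw [norm_mul, norm_mul, Complex.norm_exp, hre]
    constructor
    · rw [hn]
      gcongr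
      exact (mul_le_mul_of_nonneg_left n2 hA.le).trans e1
    · rw [norm_inv, hn, mul_inv, ← Real.exp_neg, mul_inv, norm_inv, inv_inv]
      rw [show -(-2 * π * z.re * z.im) = 2 * π * z.re * z.im by ring]
      gcongr
      exact (mul_le_mul_of_nonneg_left n1 (by positivity)).trans e2

end IsQDilog

/-- The integrand of the Ramanujan-type integral of `F (X + V) / F X`. -/
def ramKer (F : ℂ → ℂ) (μ V X : ℂ) : ℂ := (F X)⁻¹ * F (X + V) * Complex.exp (2 * π * μ * X)

/-- The Ramanujan-type integral over the horizontal line `Im X = ξ`. -/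
def ramInt (F : ℂ → ℂ) (ξ : ℝ) (μ V : ℂ) : ℂ := ∫ x : ℝ, ramKer F μ V (x + ξ * Complex.I)

/-- The Fourier transform of `1 / F` along the horizontal line `Im X = ξ`. -/
def invFT (F : ℂ → ℂ) (ξ : ℝ) (s : ℂ) : ℂ :=
  ∫ x : ℝ, (F (x + ξ * Complex.I))⁻¹ * Complex.exp (-2 * π * Complex.I * s * (x + ξ * Complex.I))

namespace IsQDilog

variable {b q : ℝ} {F : ℂ → ℂ} {A : ℂ}

lemma norm_ramKer_le (h : IsQDilog b q F A) {y : ℝ} (hy : y < q) : ∃ C, 0 < C ∧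
    ∀ μ V X : ℂ, |X.im| ≤ y → |X.im + V.im| ≤ y →
      ‖ramKer F μ V X‖ ≤ C * Real.exp (2 * π * (max X.re 0 * X.im -
        max (X.re + V.re) 0 * (X.im + V.im) + μ.re * X.re - μ.im * X.im)) := by
  obtain ⟨C, hC0, hC⟩ := h.bound hy
  refine ⟨C * C, by positivity, fun μ V X h1 h2 => ?_⟩
  have n1 := (hC X h1).2
  have n2 := (hC (X + V) (by simpa using h2)).1
  have n3 : (2 * π * μ * X).re = 2 * π * (μ.re * X.re - μ.im * X.im) := by
    simp [Complex.mul_re, Complex.mul_im]; ring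
  rw [ramKer, norm_mul, norm_mul, Complex.norm_exp, n3]
  calc _ ≤ (C * Real.exp (2 * π * max X.re 0 * X.im)) * (C * Real.exp (-2 * π *
        max (X + V).re 0 * (X + V).im)) * Real.exp (2 * π * (μ.re * X.re - μ.im * X.im)) := by
        gcongr
    _ = _ := by
      rw [show ∀ a b c d : ℝ, (a * b) * (a * c) * d = a * a * (b * c * d) by intros; ring,
        ← Real.exp_add, ← Real.exp_add]
      congr 2
      simp only [Complex.add_re, Complex.add_im]
      ring

lemma differentiableOn_ramKer (h : IsQDilog b q F A) {μ V : ℂ} {y₁ y₂ : ℝ} (h1 : -q < y₁)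
    (h2 : y₂ < q) (h3 : -q < y₁ + V.im) (h4 : y₂ + V.im < q) :
    DifferentiableOn ℂ (ramKer F μ V) {z | y₁ ≤ z.im ∧ z.im ≤ y₂} := by
  intro z hz
  have d1 := h.differentiableAt (z := z) (by linarith [hz.1]) (by linarith [hz.2])
  have d2 := h.differentiableAt (z := z + V) (by simp; linarith [hz.1]) (by simp; linarith [hz.2])
  have d3 : DifferentiableAt ℂ (fun z => F (z + V)) z :=
    d2.comp z (differentiableAt_id.add_const V)
  refine DifferentiableAt.differentiableWithinAt ?_
  unfold ramKer
  exact ((d1.inv (h.ne_zero z)).mul d3).mul (by fun_prop)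

lemma continuous_ramKer (h : IsQDilog b q F A) {μ V : ℂ} {ξ : ℝ} (h1 : -q < ξ)
    (h2 : ξ < q) (h3 : -q < ξ + V.im) (h4 : ξ + V.im < q) :
    Continuous fun x : ℝ => ramKer F μ V (x + ξ * Complex.I) := by
  have := (h.differentiableOn_ramKer (μ := μ) h1 h2 h3 h4).continuousOn
  exact this.comp_continuous (by fun_prop) (fun x => by simp)

/-- Decay of the integrand for a fixed `V`. -/
lemma norm_ramKer_le_exp_neg_abs (h : IsQDilog b q F A) {μ V : ℂ} {y₁ y₂ : ℝ} (h1 : -q < y₁)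
    (h2 : y₂ < q) (h3 : -q < y₁ + V.im) (h4 : y₂ + V.im < q) (hμ : 0 < μ.re) (hV : μ.re < V.im) :
    ∃ C κ, 0 < κ ∧ ∀ z : ℂ, y₁ ≤ z.im → z.im ≤ y₂ →
      ‖ramKer F μ V z‖ ≤ C * Real.exp (-κ * |z.re|) := by
  set y := max (max |y₁| |y₂|) (max |y₁ + V.im| |y₂ + V.im|) with hy
  rcases lt_or_ge y₂ y₁ with hlt | hle
  · exact ⟨0, 1, one_pos, fun z h5 h6 => absurd (h5.trans h6) (not_le.2 hlt)⟩
  have hyq : y < q := by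
    simp only [hy, max_lt_iff, abs_lt]
    refine ⟨⟨⟨?_, ?_⟩, ?_, ?_⟩, ⟨?_, ?_⟩, ?_, ?_⟩ <;> linarith
  obtain ⟨C, hC0, hC⟩ := h.norm_ramKer_le hyq
  refine ⟨C * Real.exp (2 * π * (|V.re| * y + |μ.im| * y)), 2 * π * min μ.re (V.im - μ.re),
    mul_pos (by positivity) (lt_min hμ (by linarith)), fun z h5 h6 => ?_⟩
  have m1 : |z.im| ≤ y := (abs_le_max_abs_abs h5 h6).trans (le_max_left _ _)
  have m2 : |z.im + V.im| ≤ y := (abs_le_max_abs_abs (by linarith) (by linarith)).trans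
    (le_max_right _ _)
  refine (hC μ V z m1 m2).trans ?_
  rw [mul_assoc C, ← Real.exp_add]
  gcongr
  have e1 : |max (z.re + V.re) 0 - max z.re 0| ≤ |V.re| := by
    simpa using abs_max_sub_max_le_abs (z.re + V.re) z.re 0
  have e2 : -((max (z.re + V.re) 0 - max z.re 0) * (z.im + V.im)) ≤ |V.re| * y :=
    (neg_le_abs _).trans ((abs_mul _ _).trans_le (mul_le_mul e1 m2 (abs_nonneg _) (abs_nonneg _)))
  have e3 : -(μ.im * z.im) ≤ |μ.im| * y :=
    (neg_le_abs _).trans ((abs_mul _ _).trans_le (mul_le_mul_of_nonneg_left m1 (abs_nonneg _)))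
  have e4 : -(max z.re 0 * V.im) + μ.re * z.re ≤ -min μ.re (V.im - μ.re) * |z.re| := by
    rcases le_total z.re 0 with hr | hr
    · rw [max_eq_right hr, abs_of_nonpos hr]
      nlinarith [min_le_left μ.re (V.im - μ.re)]
    · rw [max_eq_left hr, abs_of_nonneg hr]
      nlinarith [min_le_right μ.re (V.im - μ.re)]
  have : max z.re 0 * z.im - max (z.re + V.re) 0 * (z.im + V.im) + μ.re * z.re - μ.im * z.im ≤
      |V.re| * y + |μ.im| * y + -min μ.re (V.im - μ.re) * |z.re| := by nlinarith
  calc _ ≤ 2 * π * (|V.re| * y + |μ.im| * y + -min μ.re (V.im - μ.re) * |z.re|) := by gcongr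
    _ = _ := by ring

lemma ramInt_eq_of_le (h : IsQDilog b q F A) {μ V : ℂ} {y₁ y₂ : ℝ} (hle : y₁ ≤ y₂) (h1 : -q < y₁)
    (h2 : y₂ < q) (h3 : -q < y₁ + V.im) (h4 : y₂ + V.im < q) (hμ : 0 < μ.re) (hV : μ.re < V.im) :
    ramInt F y₁ μ V = ramInt F y₂ μ V := by
  obtain ⟨C, κ, hκ, hb⟩ := h.norm_ramKer_le_exp_neg_abs h1 h2 h3 h4 hμ hV
  exact integral_horizontal_line_eq hle (h.differentiableOn_ramKer h1 h2 h3 h4) hκ hb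

lemma ramInt_eq (h : IsQDilog b q F A) {μ V : ℂ} {y₁ y₂ : ℝ} (h1 : |y₁| < q) (h2 : |y₂| < q)
    (h3 : |y₁ + V.im| < q) (h4 : |y₂ + V.im| < q) (hμ : 0 < μ.re) (hV : μ.re < V.im) :
    ramInt F y₁ μ V = ramInt F y₂ μ V := by
  rw [abs_lt] at *
  rcases le_total y₁ y₂ with hle | hle
  · exact h.ramInt_eq_of_le hle h1.1 h2.2 h3.1 h4.2 hμ hV
  · exact (h.ramInt_eq_of_le hle h2.1 h1.2 h4.1 h3.2 hμ hV).symm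

lemma integrable_ramKer (h : IsQDilog b q F A) {μ V : ℂ} {ξ : ℝ} (h1 : |ξ| < q)
    (h2 : |ξ + V.im| < q) (hμ : 0 < μ.re) (hV : μ.re < V.im) :
    Integrable fun x : ℝ => ramKer F μ V (x + ξ * Complex.I) := by
  rw [abs_lt] at *
  obtain ⟨C, κ, hκ, hb⟩ := h.norm_ramKer_le_exp_neg_abs h1.1 h1.2 h2.1 h2.2 hμ hV
  refine integrable_of_norm_le_exp_neg_abs (h.continuous_ramKer h1.1 h1.2 h2.1 h2.2) hκ
    (fun x => ?_) (C := C)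
  simpa using hb (x + ξ * Complex.I) (by simp) (by simp)

/-- Bound on the integrand, uniform for `V` in a horizontal strip. -/
lemma norm_ramKer_window_le (h : IsQDilog b q F A) {μ : ℂ} {ξ ρ : ℝ} (hρ : 0 < ρ) (hμ : 0 < μ.re)
    (h1 : -q + ρ ≤ ξ) (h2 : ξ ≤ -μ.re - 3 * ρ) :
    ∃ C κ, 0 < C ∧ 0 < κ ∧ ∀ (V : ℂ) (x : ℝ), -2 * ρ < ξ + V.im → ξ + V.im < q - ρ →
      ‖ramKer F μ V (x + ξ * Complex.I)‖ ≤
        C * Real.exp (2 * π * (2 * ρ * max V.re 0)) * Real.exp (-κ * |x|) := by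
  obtain ⟨C, hC0, hC⟩ := h.norm_ramKer_le (y := q - ρ) (by linarith)
  refine ⟨C * Real.exp (2 * π * (|μ.im| * |ξ|)), 2 * π * min ρ μ.re, by positivity,
    mul_pos (by positivity) (lt_min hρ hμ), fun V x h3 h4 => ?_⟩
  refine (hC μ V _ (by simp [abs_le]; constructor <;> linarith)
    (by simp [abs_le]; constructor <;> linarith)).trans ?_
  rw [mul_assoc C, mul_assoc C, ← Real.exp_add, ← Real.exp_add]
  gcongr
  simp only [Complex.add_re, Complex.ofReal_re, Complex.mul_re, Complex.I_re, mul_zero,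
    Complex.ofReal_im, Complex.I_im, mul_one, sub_self, add_zero, Complex.add_im, Complex.mul_im,
    zero_add]
  have e1 : max (x + V.re) 0 ≤ max x 0 + max V.re 0 :=
    max_le (add_le_add (le_max_left _ _) (le_max_left _ _))
      (add_nonneg (le_max_right _ _) (le_max_right _ _))
  have e2 : -(max (x + V.re) 0 * (ξ + V.im)) ≤ 2 * ρ * (max x 0 + max V.re 0) := by
    have : 0 ≤ max (x + V.re) 0 := le_max_right _ _
    nlinarith
  have e3 : -(μ.im * ξ) ≤ |μ.im| * |ξ| := (neg_le_abs _).trans (abs_mul _ _).le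
  have e4 : max x 0 * (ξ + 2 * ρ) + μ.re * x ≤ -min ρ μ.re * |x| := by
    rcases le_total x 0 with hr | hr
    · rw [max_eq_right hr, abs_of_nonpos hr]
      nlinarith [min_le_right ρ μ.re]
    · rw [max_eq_left hr, abs_of_nonneg hr]
      nlinarith [min_le_left ρ μ.re]
  have : max x 0 * ξ - max (x + V.re) 0 * (ξ + V.im) + μ.re * x - μ.im * ξ ≤
      |μ.im| * |ξ| + (2 * ρ * max V.re 0) + -min ρ μ.re * |x| := by nlinarith
  calc _ ≤ 2 * π * (|μ.im| * |ξ| + (2 * ρ * max V.re 0) + -min ρ μ.re * |x|) := by gcongr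
    _ = _ := by ring

lemma norm_ramInt_le (h : IsQDilog b q F A) {μ : ℂ} {ξ ρ : ℝ} (hρ : 0 < ρ) (hμ : 0 < μ.re)
    (h1 : -q + ρ ≤ ξ) (h2 : ξ ≤ -μ.re - 3 * ρ) :
    ∃ C, 0 < C ∧ ∀ V : ℂ, -2 * ρ < ξ + V.im → ξ + V.im < q - ρ →
      ‖ramInt F ξ μ V‖ ≤ C * Real.exp (2 * π * (2 * ρ * max V.re 0)) := by
  obtain ⟨C, κ, hC0, hκ, hC⟩ := h.norm_ramKer_window_le hρ hμ h1 h2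
  have hI := integrable_exp_neg_mul_abs hκ
  have hI0 : 0 ≤ ∫ x : ℝ, Real.exp (-κ * |x|) := integral_nonneg fun x => (Real.exp_pos _).le
  refine ⟨C * (1 + ∫ x : ℝ, Real.exp (-κ * |x|)), by positivity, fun V h3 h4 => ?_⟩
  have := norm_integral_le_of_norm_le (hI.const_mul (C * Real.exp (2 * π * (2 * ρ * max V.re 0))))
    (Filter.Eventually.of_forall fun x => hC V x h3 h4)
  rw [integral_const_mul] at this
  refine this.trans ?_
  rw [mul_right_comm]
  gcongr
  linarith

lemma differentiableOn_ramInt (h : IsQDilog b q F A) {μ : ℂ} {ξ ρ : ℝ} (hρ : 0 < ρ)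
    (hμ : 0 < μ.re) (h1 : -q + ρ ≤ ξ) (h2 : ξ ≤ -μ.re - 3 * ρ) :
    DifferentiableOn ℂ (ramInt F ξ μ) {V | -2 * ρ - ξ < V.im ∧ V.im < q - ρ - ξ} := by
  obtain ⟨C, κ, hC0, hκ, hC⟩ := h.norm_ramKer_window_le hρ hμ h1 h2
  intro V₀ hV₀
  obtain ⟨r, hr, hball⟩ := Metric.isOpen_iff.1 (isOpen_im_strip (-2 * ρ - ξ) (q - ρ - ξ)) V₀ hV₀
  refine (hasDerivAt_integral_of_holomorphic (f := fun V x => ramKer F μ V (x + ξ * Complex.I))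
    (g := fun x => C * Real.exp (2 * π * (2 * ρ * (max V₀.re 0 + r))) * Real.exp (-κ * |x|))
    hr (fun x V hV => ?_) (fun V hV => ?_) ((integrable_exp_neg_mul_abs hκ).const_mul _)
    (fun V hV x => ?_)).differentiableAt.differentiableWithinAt
  · obtain ⟨k1, k2⟩ := hball hV
    have d := h.differentiableAt (z := x + ξ * Complex.I + V) (by simp; linarith)
      (by simp; linarith)
    have d3 : DifferentiableAt ℂ (fun V => F (x + ξ * Complex.I + V)) V :=
      d.comp V (differentiableAt_id.const_add _)
    unfold ramKer
    exact ((d3.const_mul _).mul_const _).differentiableWithinAt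
  · obtain ⟨k1, k2⟩ := hball hV
    exact (h.continuous_ramKer (by linarith) (by linarith) (by linarith)
      (by linarith)).aestronglyMeasurable
  · obtain ⟨k1, k2⟩ := hball hV
    refine (hC V x (by linarith) (by linarith)).trans ?_
    have : max V.re 0 ≤ max V₀.re 0 + r := by
      have e1 : |V.re - V₀.re| ≤ r := (Complex.abs_re_le_norm (V - V₀)).trans
        (mem_ball_iff_norm.1 hV).le
      refine max_le ?_ (by positivity)
      linarith [le_max_left V₀.re 0, (abs_le.1 e1).2]
    gcongr

lemma ramInt_add_mul_I (h : IsQDilog b q F A) {μ V : ℂ} {ξ ρ : ℝ} (hρ : 0 < ρ)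
    (hμ : 0 < μ.re) (h1 : -q + ρ ≤ ξ) (h2 : ξ ≤ -μ.re - 3 * ρ) (h3 : -2 * ρ < ξ + V.im)
    (h4 : ξ + V.im + b < q - ρ) :
    ramInt F ξ μ (V + b * Complex.I) * (1 - Complex.exp (2 * π * b * V)) =
      ramInt F ξ μ V * (1 - Complex.exp (2 * π * b * (V - Complex.I * μ))) := by
  have hb := h.b_pos
  have hbq := h.b_le_q
  set W := V + b * Complex.I with hW
  have hWim : W.im = V.im + b := by simp [hW]
  have i0 : Integrable fun x : ℝ => ramKer F μ W (x + ξ * Complex.I) :=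
    h.integrable_ramKer (abs_lt.2 ⟨by linarith, by linarith⟩)
      (abs_lt.2 ⟨by linarith, by linarith⟩) hμ (by linarith)
  have i1 : Integrable fun x : ℝ => ramKer F μ V (x + ξ * Complex.I) :=
    h.integrable_ramKer (abs_lt.2 ⟨by linarith, by linarith⟩)
      (abs_lt.2 ⟨by linarith, by linarith⟩) hμ (by linarith)
  have i2 : Integrable fun x : ℝ => ramKer F μ V (x + (ξ + b : ℝ) * Complex.I) :=
    h.integrable_ramKer (abs_lt.2 ⟨by linarith, by linarith⟩)
      (abs_lt.2 ⟨by linarith, by linarith⟩) hμ (by linarith)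
  have hs : ramInt F ξ μ V = ramInt F (ξ + b) μ V :=
    h.ramInt_eq (abs_lt.2 ⟨by linarith, by linarith⟩) (abs_lt.2 ⟨by linarith, by linarith⟩)
      (abs_lt.2 ⟨by linarith, by linarith⟩) (abs_lt.2 ⟨by linarith, by linarith⟩) hμ (by linarith)
  have hpt : ∀ x : ℝ, Complex.exp (2 * π * b * (V - Complex.I * μ)) *
      ramKer F μ V (x + (ξ + b : ℝ) * Complex.I) - Complex.exp (2 * π * b * V) *
      ramKer F μ W (x + ξ * Complex.I) =
      ramKer F μ V (x + ξ * Complex.I) - ramKer F μ W (x + ξ * Complex.I) := by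
    intro x
    set X : ℂ := x + ξ * Complex.I with hX
    have hXim : X.im = ξ := by simp [hX]
    have s1 := h.shift (X + V) (by simp [hXim]; linarith) (by simp [hXim]; linarith)
    have s2 := h.shift X (by linarith) (by linarith)
    have hXb : (x : ℂ) + (ξ + b : ℝ) * Complex.I = X + b * Complex.I := by
      rw [hX]; push_cast; ring
    have hXW : X + V + b * Complex.I = X + W := by rw [hW]; ring
    rw [hXb]
    simp only [ramKer]
    rw [show X + b * Complex.I + V = X + W by rw [hW]; ring]
    rw [hXW] at s1
    have n0 := h.ne_zero X
    have n1 := h.ne_zero (X + b * Complex.I)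
    have s2' : (F (X + b * Complex.I))⁻¹ =
        (1 + Complex.exp (2 * π * b * (X + b / 2 * Complex.I))) * (F X)⁻¹ := by
      have n2 : 1 + Complex.exp (2 * π * b * (X + b / 2 * Complex.I)) ≠ 0 := by
        intro hz; rw [hz, zero_mul] at s2; exact n0 s2
      rw [s2, mul_inv, mul_inv_cancel_left₀ n2]
    rw [s1, s2', show 2 * π * b * (X + V + b / 2 * Complex.I) =
      2 * π * b * V + 2 * π * b * (X + b / 2 * Complex.I) by ring, Complex.exp_add,
      show 2 * π * b * (V - Complex.I * μ) = 2 * π * b * V + -(2 * π * b * Complex.I * μ) by ring,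
      Complex.exp_add, show 2 * π * μ * (X + b * Complex.I) = 2 * π * b * Complex.I * μ +
      2 * π * μ * X by ring, Complex.exp_add _ (2 * π * μ * X)]
    have hc : Complex.exp (-(2 * π * b * Complex.I * μ)) *
        Complex.exp (2 * π * b * Complex.I * μ) = 1 := by rw [← Complex.exp_add]; simp
    linear_combination (Complex.exp (2 * π * b * V) *
      (1 + Complex.exp (2 * π * b * (X + b / 2 * Complex.I))) * (F X)⁻¹ * F (X + W) *
      Complex.exp (2 * π * μ * X)) * hc
  have hint := congrArg (fun f : ℝ → ℂ => ∫ x, f x) (funext hpt)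
  rw [integral_sub (i2.const_mul _) (i0.const_mul _), integral_sub i1 i0, integral_const_mul,
    integral_const_mul] at hint
  change _ * ramInt F (ξ + b) μ V - _ * ramInt F ξ μ W = ramInt F ξ μ V - ramInt F ξ μ W at hint
  rw [← hs] at hint
  linear_combination hint

lemma shift_sub_q (h : IsQDilog b q F A) {V : ℂ} (h1 : 0 < V.im) (h2 : V.im + b < 2 * q) :
    F (V - Complex.I * q) = (1 - Complex.exp (2 * π * b * V)) *
      F (V + b * Complex.I - Complex.I * q) := by
  have hb : (b : ℂ) ≠ 0 := mod_cast h.b_pos.ne'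
  have h2q : (2 * q : ℂ) = b + (b : ℂ)⁻¹ := mod_cast congrArg (fun x : ℝ => (x : ℂ)) h.two_q
  have hs := h.shift (V - Complex.I * q) (by simp; linarith) (by simp; linarith)
  rw [show 2 * π * b * (V - Complex.I * q + b / 2 * Complex.I) = 2 * π * b * V + -(π * Complex.I) by
      have : (b : ℂ) * (2 * q) = b * b + 1 := by rw [h2q, mul_add, mul_inv_cancel₀ hb]
      linear_combination (-π * Complex.I) * this, Complex.exp_add, Complex.exp_neg,
    Complex.exp_pi_mul_I] at hs
  rw [hs, show V - Complex.I * q + b * Complex.I = V + b * Complex.I - Complex.I * q by ring]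
  ring

lemma norm_ratio_le (h : IsQDilog b q F A) (μ : ℂ) (hμ : 0 < μ.re) {ρ : ℝ} (hρ : 0 < ρ) :
    ∃ C, 0 < C ∧ ∀ V : ℂ, μ.re + ρ ≤ V.im → V.im ≤ 2 * q - ρ →
      ‖F (V - Complex.I * μ - Complex.I * q) * (F (V - Complex.I * q))⁻¹‖ ≤
        C * Real.exp (2 * π * (μ.re * max V.re 0)) := by
  obtain ⟨C, hC0, hC⟩ := h.bound (y := q - ρ) (by linarith)
  refine ⟨C * C * Real.exp (2 * π * (|μ.im| * q)), by positivity, fun V h1 h2 => ?_⟩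
  have m1 : |(V - Complex.I * μ - Complex.I * q).im| ≤ q - ρ := by
    simp [abs_le]; constructor <;> linarith
  have m2 : |(V - Complex.I * q).im| ≤ q - ρ := by
    simp [abs_le]; constructor <;> linarith
  have r1 := (hC _ m1).1
  have r2 := (hC _ m2).2
  rw [norm_mul]
  refine (mul_le_mul r1 r2 (norm_nonneg _) (by positivity)).trans ?_
  rw [show ∀ a b c : ℝ, (a * b) * (a * c) = a * a * (b * c) by intros; ring, ← Real.exp_add,
    mul_assoc (C * C), ← Real.exp_add]
  refine mul_le_mul_of_nonneg_left (Real.exp_le_exp.2 ?_) (by positivity)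
  have e1 : |max (V - Complex.I * μ - Complex.I * q).re 0 - max V.re 0| ≤ |μ.im| := by
    simpa using abs_max_sub_max_le_abs (V.re + μ.im) V.re 0
  have e2 := (neg_le_abs _).trans ((abs_mul _ _).trans_le
    (mul_le_mul e1 (m1.trans (by linarith : q - ρ ≤ q)) (abs_nonneg _) (abs_nonneg _)))
  have i1 : (V - Complex.I * μ - Complex.I * q).im = V.im - μ.re - q := by simp
  have i2 : (V - Complex.I * q).im = V.im - q := by simp
  have i3 : (V - Complex.I * q).re = V.re := by simp
  rw [i1] at e2 ⊢
  rw [i2, i3]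
  calc _ = 2 * π * (-((max (V - Complex.I * μ - Complex.I * q).re 0 - max V.re 0) *
        (V.im - μ.re - q)) + μ.re * max V.re 0) := by ring
    _ ≤ 2 * π * (|μ.im| * q + μ.re * max V.re 0) := by gcongr
    _ = _ := by ring

lemma tendsto_ramInt (h : IsQDilog b q F A) {μ : ℂ} {ξ ρ ν : ℝ} (hρ : 0 < ρ)
    (hμ : 0 < μ.re) (h1 : -q + ρ ≤ ξ) (h2 : ξ ≤ -μ.re - 3 * ρ) (h3 : -2 * ρ < ξ + ν)
    (h4 : ξ + ν < q - ρ) :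
    Filter.Tendsto (fun u : ℝ => ramInt F ξ μ (u + ν * Complex.I)) Filter.atBot
      (nhds (invFT F ξ (Complex.I * μ))) := by
  obtain ⟨C, κ, hC0, hκ, hC⟩ := h.norm_ramKer_window_le hρ hμ h1 h2
  refine tendsto_integral_filter_of_dominated_convergence
    (fun x => C * 1 * Real.exp (-κ * |x|)) (Filter.Eventually.of_forall fun u => ?_) ?_
    ((integrable_exp_neg_mul_abs hκ).const_mul _) (Filter.Eventually.of_forall fun x => ?_)
  · exact (h.continuous_ramKer (by linarith) (by linarith) (by simp; linarith)
      (by simp; linarith)).aestronglyMeasurable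
  · filter_upwards [Filter.eventually_le_atBot 0] with u hu
    refine Filter.Eventually.of_forall fun x => ?_
    have := hC (u + ν * Complex.I) x (by simpa using h3) (by simpa using h4)
    simpa [max_eq_right hu] using this
  · have t1 : Filter.Tendsto (fun u : ℝ => F ((u + x : ℝ) + (ξ + ν : ℝ) * Complex.I))
        Filter.atBot (nhds 1) :=
      (h.tendsto_left (ξ + ν) (abs_lt.2 ⟨by linarith, by linarith⟩)).comp
        (Filter.tendsto_atBot_add_const_right _ x Filter.tendsto_id)
    have t2 := (t1.const_mul (F (x + ξ * Complex.I))⁻¹).mul_const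
      (Complex.exp (2 * π * μ * (x + ξ * Complex.I)))
    rw [mul_one, show 2 * π * μ * (x + ξ * Complex.I) =
      -2 * π * Complex.I * (Complex.I * μ) * (x + ξ * Complex.I) by
        linear_combination (2 * π * μ * (x + ξ * Complex.I)) * Complex.I_sq] at t2
    refine t2.congr fun u => ?_
    rw [ramKer, show (x : ℂ) + ξ * Complex.I + (u + ν * Complex.I) =
      ((u + x : ℝ) : ℂ) + (ξ + ν : ℝ) * Complex.I by push_cast; ring]
    congr 2
    linear_combination (-2 * π * μ * (x + ξ * Complex.I)) * Complex.I_sq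

lemma ramInt_window (h : IsQDilog b q F A) {μ V : ℂ} {ξ ρ : ℝ} (hρ : 0 < ρ)
    (hμ : 0 < μ.re) (h1 : -q + ρ ≤ ξ) (h2 : ξ ≤ -μ.re - 3 * ρ) (h3 : -2 * ρ < ξ + V.im)
    (h4 : ξ + V.im < q - ρ) :
    ramInt F ξ μ V = invFT F ξ (Complex.I * μ) *
      ((F (V - Complex.I * μ - Complex.I * q))⁻¹ * F (V - Complex.I * q)) := by
  have hb := h.b_pos
  have hbq := h.b_le_q
  set G : ℂ → ℂ := fun V => ramInt F ξ μ V *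
    (F (V - Complex.I * μ - Complex.I * q) * (F (V - Complex.I * q))⁻¹) with hG
  obtain ⟨C₁, hC₁, hR⟩ := h.norm_ramInt_le hρ hμ h1 h2
  obtain ⟨C₂, hC₂, hQ⟩ := h.norm_ratio_le μ hμ hρ
  have hbd : ∀ z : ℂ, -2 * ρ - ξ < z.im → z.im < q - ρ - ξ →
      ‖G z‖ ≤ C₁ * C₂ * Real.exp (2 * π * ((μ.re + 2 * ρ) * max z.re 0)) := by
    intro z k1 k2
    rw [hG, norm_mul]
    refine (mul_le_mul (hR z (by linarith) (by linarith)) (hQ z (by linarith) (by linarith))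
      (norm_nonneg _) (by positivity)).trans (le_of_eq ?_)
    rw [show ∀ a b c d : ℝ, (a * b) * (c * d) = a * c * (b * d) by intros; ring, ← Real.exp_add]
    congr 2; ring
  have hdiff : DifferentiableOn ℂ G {z | -2 * ρ - ξ < z.im ∧ z.im < q - ρ - ξ} := by
    refine (h.differentiableOn_ramInt hρ hμ h1 h2).mul fun z hz => ?_
    obtain ⟨k1, k2⟩ := hz
    have d1 := h.differentiableAt (z := z - Complex.I * μ - Complex.I * q) (by simp; linarith)
      (by simp; linarith)
    have d2 := h.differentiableAt (z := z - Complex.I * q) (by simp; linarith)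
      (by simp; linarith)
    have d3 : DifferentiableAt ℂ (fun z => F (z - Complex.I * μ - Complex.I * q)) z :=
      d1.comp z ((differentiableAt_id.sub_const _).sub_const _)
    have d4 : DifferentiableAt ℂ (fun z => F (z - Complex.I * q)) z :=
      d2.comp z (differentiableAt_id.sub_const _)
    exact (d3.mul (d4.inv (h.ne_zero _))).differentiableWithinAt
  have hper : ∀ z : ℂ, -2 * ρ - ξ < z.im → z.im + b < q - ρ - ξ → G (z + b * Complex.I) = G z := by
    intro z k1 k2
    have r1 := h.ramInt_add_mul_I hρ hμ h1 h2 (V := z) (by linarith) (by linarith)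
    have r2 := h.shift_sub_q (V := z) (by linarith) (by linarith)
    have r3 := h.shift_sub_q (V := z - Complex.I * μ) (by simp; linarith) (by simp; linarith)
    rw [show z - Complex.I * μ + b * Complex.I - Complex.I * q =
      z + b * Complex.I - Complex.I * μ - Complex.I * q by ring] at r3
    simp only [hG]
    rw [r2, r3]
    have n1 : 1 - Complex.exp (2 * π * b * z) ≠ 0 := by
      intro hz; rw [hz, zero_mul] at r2; exact h.ne_zero _ r2
    have n2 := h.ne_zero (z + b * Complex.I - Complex.I * q)
    rw [mul_inv]
    calc _ = ramInt F ξ μ (z + b * Complex.I) * (1 - Complex.exp (2 * π * b * z)) *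
          (1 - Complex.exp (2 * π * b * z))⁻¹ *
          (F (z + b * Complex.I - Complex.I * μ - Complex.I * q) *
            (F (z + b * Complex.I - Complex.I * q))⁻¹) := by
          rw [mul_inv_cancel_right₀ n1]
      _ = _ := by rw [r1]; ring
  have hθ : b * (μ.re + 2 * ρ) < 1 :=
    (mul_lt_mul_of_pos_left (by linarith) hb).trans_le h.b_mul_q_le_one
  obtain ⟨K, hK⟩ := eq_of_periodic_strip (C := C₁ * C₂) hb (by linarith) hdiff hper hθ
    (fun z k1 k2 hr => by simpa [max_eq_right hr] using hbd z k1 k2)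
    (fun z k1 k2 hr => by
      have := hbd z k1 k2
      rw [max_eq_left hr] at this
      refine this.trans (le_of_eq ?_)
      congr 2
      field_simp)
  have hlim : Filter.Tendsto (fun u : ℝ => G (u + V.im * Complex.I)) Filter.atBot
      (nhds (invFT F ξ (Complex.I * μ) * (1 * 1⁻¹))) := by
    refine (h.tendsto_ramInt hρ hμ h1 h2 h3 h4).mul (Filter.Tendsto.mul ?_ (Filter.Tendsto.inv₀ ?_
      one_ne_zero))
    · have t := (h.tendsto_left (V.im - μ.re - q) (abs_lt.2 ⟨by linarith, by linarith⟩)).comp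
        (Filter.tendsto_atBot_add_const_right _ μ.im Filter.tendsto_id)
      refine t.congr fun u => ?_
      simp only [Function.comp, id]
      congr 1
      apply Complex.ext <;> simp
    · have t := h.tendsto_left (V.im - q) (abs_lt.2 ⟨by linarith, by linarith⟩)
      refine t.congr fun u => ?_
      congr 1
      apply Complex.ext <;> simp
  have hKlim : K = invFT F ξ (Complex.I * μ) := by
    have hc : Filter.Tendsto (fun u : ℝ => G (u + V.im * Complex.I)) Filter.atBot (nhds K) :=
      tendsto_const_nhds.congr fun u =>
        (hK _ (by simp; linarith) (by simp; linarith)).symm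
    simpa using tendsto_nhds_unique hc hlim
  have hV := hK V (by linarith) (by linarith)
  rw [← hKlim, ← hV]
  simp only [hG]
  have n1 := h.ne_zero (V - Complex.I * μ - Complex.I * q)
  have n2 := h.ne_zero (V - Complex.I * q)
  field_simp

/-- The Ramanujan-type formula, with the Fourier transform taken over a suitable line. -/
lemma exists_ramInt_eq (h : IsQDilog b q F A) {μ V : ℂ} {ξ : ℝ} (hμ : 0 < μ.re) (hμq : μ.re < q)
    (hV : μ.re < V.im) (hVq : V.im < 2 * q) (h1 : |ξ| < q) (h2 : |ξ + V.im| < q) :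
    ∃ ξ₀, -q < ξ₀ ∧ ξ₀ < -μ.re ∧ ramInt F ξ μ V = invFT F ξ₀ (Complex.I * μ) *
      ((F (V - Complex.I * μ - Complex.I * q))⁻¹ * F (V - Complex.I * q)) := by
  obtain ⟨ρ, hρ, r1, r2, r3⟩ : ∃ ρ, 0 < ρ ∧ 4 * ρ ≤ q - μ.re ∧ 4 * ρ ≤ V.im - μ.re ∧
      4 * ρ ≤ 2 * q - V.im := by
    refine ⟨min (min (q - μ.re) (V.im - μ.re)) (2 * q - V.im) / 4, ?_, ?_, ?_, ?_⟩
    · have : 0 < min (min (q - μ.re) (V.im - μ.re)) (2 * q - V.im) :=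
        lt_min (lt_min (by linarith) (by linarith)) (by linarith)
      linarith
    · linarith [min_le_left (min (q - μ.re) (V.im - μ.re)) (2 * q - V.im),
        min_le_left (q - μ.re) (V.im - μ.re)]
    · linarith [min_le_left (min (q - μ.re) (V.im - μ.re)) (2 * q - V.im),
        min_le_right (q - μ.re) (V.im - μ.re)]
    · linarith [min_le_right (min (q - μ.re) (V.im - μ.re)) (2 * q - V.im)]
  set ξ₀ := max (-q + ρ) (-V.im - ρ) with hξ₀
  have k1 : -q + ρ ≤ ξ₀ := le_max_left _ _
  have k2 : -V.im - ρ ≤ ξ₀ := le_max_right _ _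
  have k3 : ξ₀ ≤ -μ.re - 3 * ρ := max_le (by linarith) (by linarith)
  have k4 : ξ₀ < q - ρ - V.im := max_lt (by linarith) (by linarith)
  refine ⟨ξ₀, by linarith, by linarith, ?_⟩
  rw [h.ramInt_eq h1 (abs_lt.2 ⟨by linarith, by linarith⟩) h2
    (abs_lt.2 ⟨by linarith, by linarith⟩) hμ hV]
  exact h.ramInt_window hρ hμ k1 k3 (by linarith) (by linarith)

lemma differentiableOn_invFT_kernel (h : IsQDilog b q F A) (s : ℂ) {y₁ y₂ : ℝ} (h1 : -q < y₁)
    (h2 : y₂ < q) : DifferentiableOn ℂ (fun z => (F z)⁻¹ * Complex.exp (-2 * π * Complex.I * s * z))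
      {z | y₁ ≤ z.im ∧ z.im ≤ y₂} := fun z hz =>
  (((h.differentiableAt (by linarith [hz.1]) (by linarith [hz.2])).inv (h.ne_zero z)).mul
    (by fun_prop)).differentiableWithinAt

lemma norm_invFT_kernel_le (h : IsQDilog b q F A) {s : ℂ} {y₁ y₂ : ℝ} (h1 : -q < y₁)
    (hs : 0 < s.im) (h2 : y₂ < -s.im) :
    ∃ C κ, 0 < κ ∧ ∀ z : ℂ, y₁ ≤ z.im → z.im ≤ y₂ →
      ‖(F z)⁻¹ * Complex.exp (-2 * π * Complex.I * s * z)‖ ≤ C * Real.exp (-κ * |z.re|) := by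
  have hq := h.q_pos
  rcases lt_or_ge y₂ y₁ with hlt | hle
  · exact ⟨0, 1, one_pos, fun z h5 h6 => absurd (h5.trans h6) (not_le.2 hlt)⟩
  have hy : max |y₁| |y₂| < q := by
    simp only [max_lt_iff, abs_lt]
    refine ⟨⟨?_, ?_⟩, ?_, ?_⟩ <;> linarith
  obtain ⟨C, hC0, hC⟩ := h.bound hy
  refine ⟨C * Real.exp (2 * π * (|s.re| * max |y₁| |y₂|)), 2 * π * min s.im (-y₂ - s.im),
    mul_pos (by positivity) (lt_min hs (by linarith)), fun z h5 h6 => ?_⟩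
  have m1 : |z.im| ≤ max |y₁| |y₂| := abs_le_max_abs_abs h5 h6
  have n1 := (hC z m1).2
  have n3 : (-2 * π * Complex.I * s * z).re = 2 * π * (s.re * z.im + s.im * z.re) := by
    simp [Complex.mul_re, Complex.mul_im]; ring
  rw [norm_mul, Complex.norm_exp, n3]
  refine (mul_le_mul_of_nonneg_right n1 (Real.exp_pos _).le).trans ?_
  rw [mul_assoc C, mul_assoc C, ← Real.exp_add, ← Real.exp_add]
  refine mul_le_mul_of_nonneg_left (Real.exp_le_exp.2 ?_) hC0.le
  have e3 : s.re * z.im ≤ |s.re| * max |y₁| |y₂| :=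
    (le_abs_self _).trans ((abs_mul _ _).trans_le (mul_le_mul_of_nonneg_left m1 (abs_nonneg _)))
  have e4 : max z.re 0 * z.im + s.im * z.re ≤ -min s.im (-y₂ - s.im) * |z.re| := by
    rcases le_total z.re 0 with hr | hr
    · rw [max_eq_right hr, abs_of_nonpos hr]
      nlinarith [min_le_left s.im (-y₂ - s.im)]
    · rw [max_eq_left hr, abs_of_nonneg hr]
      nlinarith [min_le_right s.im (-y₂ - s.im)]
  calc _ = 2 * π * (max z.re 0 * z.im + s.im * z.re + s.re * z.im) := by ring
    _ ≤ 2 * π * (-min s.im (-y₂ - s.im) * |z.re| + |s.re| * max |y₁| |y₂|) := by gcongr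
    _ = _ := by ring

lemma continuous_invFT_kernel (h : IsQDilog b q F A) (s : ℂ) {ξ : ℝ} (h1 : |ξ| < q) :
    Continuous fun x : ℝ => (F (x + ξ * Complex.I))⁻¹ *
      Complex.exp (-2 * π * Complex.I * s * (x + ξ * Complex.I)) :=
  (h.differentiableOn_invFT_kernel s (abs_lt.1 h1).1 (abs_lt.1 h1).2).continuousOn.comp_continuous
    (by fun_prop : Continuous fun x : ℝ => (x : ℂ) + ξ * Complex.I) (fun x => by simp)

lemma invFT_eq_of_le (h : IsQDilog b q F A) {s : ℂ} {y₁ y₂ : ℝ} (hle : y₁ ≤ y₂) (h1 : -q < y₁)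
    (hs : 0 < s.im) (h2 : y₂ < -s.im) : invFT F y₁ s = invFT F y₂ s := by
  obtain ⟨C, κ, hκ, hb⟩ := h.norm_invFT_kernel_le h1 hs h2
  exact integral_horizontal_line_eq hle
    (h.differentiableOn_invFT_kernel s h1 (by linarith [h.q_pos])) hκ hb

lemma invFT_eq (h : IsQDilog b q F A) {s : ℂ} {y₁ y₂ : ℝ} (hs : 0 < s.im) (h1 : -q < y₁)
    (h2 : y₁ < -s.im) (h3 : -q < y₂) (h4 : y₂ < -s.im) : invFT F y₁ s = invFT F y₂ s := by
  rcases le_total y₁ y₂ with hle | hle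
  · exact h.invFT_eq_of_le hle h1 hs h4
  · exact (h.invFT_eq_of_le hle h3 hs h2).symm

/-- The Ramanujan-type formula. -/
lemma ramInt_eq_invFT_mul (h : IsQDilog b q F A) {μ V : ℂ} {ξ ξ₀ : ℝ} (hμ : 0 < μ.re)
    (hV : μ.re < V.im) (hVq : V.im < 2 * q) (h1 : |ξ| < q) (h2 : |ξ + V.im| < q)
    (h3 : -q < ξ₀) (h4 : ξ₀ < -μ.re) :
    ramInt F ξ μ V = invFT F ξ₀ (Complex.I * μ) *
      ((F (V - Complex.I * μ - Complex.I * q))⁻¹ * F (V - Complex.I * q)) := by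
  obtain ⟨ξ₁, k1, k2, k3⟩ := h.exists_ramInt_eq hμ (by linarith) hV hVq h1 h2
  rw [k3, h.invFT_eq (by simpa using hμ) k1 (by simpa using k2) h3 (by simpa using h4)]

lemma ramInt_symm (h : IsQDilog b q F A) (μ V : ℂ) {ξ : ℝ} (h1 : |ξ| < q)
    (h2 : |ξ + V.im| < q) :
    ramInt F ξ μ V = Complex.exp (-(Complex.I * π * V ^ 2) - 2 * π * μ * V) *
      ramInt F (-ξ - V.im) (-(Complex.I * V) - μ) V := by
  have hpt : ∀ x : ℝ, ramKer F μ V (x + ξ * Complex.I) =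
      Complex.exp (-(Complex.I * π * V ^ 2) - 2 * π * μ * V) *
      ramKer F (-(Complex.I * V) - μ) V (((-V.re - x : ℝ) : ℂ) +
        ((-ξ - V.im : ℝ) : ℂ) * Complex.I) := by
    intro x
    set X : ℂ := x + ξ * Complex.I with hX
    have hXim : X.im = ξ := by simp [hX]
    have hY : ((-V.re - x : ℝ) : ℂ) + ((-ξ - V.im : ℝ) : ℂ) * Complex.I = -(X + V) := by
      apply Complex.ext <;> simp [hX]
      · ring
      · ring
    rw [hY]
    have r1 := h.inversion X (by rw [hXim]; exact (abs_lt.1 h1).1)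
      (by rw [hXim]; exact (abs_lt.1 h1).2)
    have r2 := h.inversion (X + V) (by simpa [hXim] using (abs_lt.1 h2).1)
      (by simpa [hXim] using (abs_lt.1 h2).2)
    have hA := h.A_ne_zero
    have n1 := h.ne_zero X
    have n2 := h.ne_zero (-(X + V))
    have r1' : (F X)⁻¹ = F (-X) * A⁻¹ * Complex.exp (-(Complex.I * π * X ^ 2)) := by
      rw [Complex.exp_neg, mul_assoc, ← mul_inv, ← r1, mul_inv, mul_comm (F X)⁻¹,
        mul_inv_cancel_left₀ (h.ne_zero _)]
    have r2' : F (X + V) = (F (-(X + V)))⁻¹ * A * Complex.exp (Complex.I * π * (X + V) ^ 2) := by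
      rw [mul_assoc, ← r2, mul_comm (F (X + V)), inv_mul_cancel_left₀ n2]
    simp only [ramKer]
    rw [r1', r2', show -(X + V) + V = -X by ring]
    rw [show F (-X) * A⁻¹ * Complex.exp (-(Complex.I * π * X ^ 2)) * ((F (-(X + V)))⁻¹ * A *
      Complex.exp (Complex.I * π * (X + V) ^ 2)) * Complex.exp (2 * π * μ * X) =
      (A⁻¹ * A) * ((F (-(X + V)))⁻¹ * F (-X)) * (Complex.exp (-(Complex.I * π * X ^ 2)) *
      Complex.exp (Complex.I * π * (X + V) ^ 2) * Complex.exp (2 * π * μ * X)) by ring,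
      inv_mul_cancel₀ hA, one_mul,
      mul_left_comm (Complex.exp (-(Complex.I * π * V ^ 2) - 2 * π * μ * V)), ← Complex.exp_add,
      ← Complex.exp_add, ← Complex.exp_add]
    congr 2
    ring
  simp only [ramInt]
  simp_rw [hpt]
  rw [integral_const_mul]
  congr 1
  exact integral_sub_left_eq_self (fun y : ℝ => ramKer F (-(Complex.I * V) - μ) V
    ((y : ℂ) + ((-ξ - V.im : ℝ) : ℂ) * Complex.I)) volume (-V.re)

lemma invFT_mul_eq (h : IsQDilog b q F A) {s s' : ℂ} {ξ ξ' : ℝ} (hs : 0 < s.im) (hξ : -q < ξ)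
    (hsξ : ξ < -s.im) (hs' : 0 < s'.im) (hξ' : -q < ξ') (hsξ' : ξ' < -s'.im) :
    invFT F ξ s * Complex.exp (-(Complex.I * π * s ^ 2)) * F (s - Complex.I * q) =
      invFT F ξ' s' * Complex.exp (-(Complex.I * π * s' ^ 2)) * F (s' - Complex.I * q) := by
  have hI : ∀ w : ℂ, Complex.I * (-(Complex.I * w)) = w := fun w => by
    linear_combination (-w) * Complex.I_sq
  have hq := h.q_pos
  set V := s + s' with hV
  set μ := -(Complex.I * s) with hμ
  have hVim : V.im = s.im + s'.im := by simp [hV]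
  have hμre : μ.re = s.im := by simp [hμ]
  set η := -V.im / 2 with hη
  have a1 : |η| < q := abs_lt.2 ⟨by linarith, by linarith⟩
  have a2 : |η + V.im| < q := abs_lt.2 ⟨by linarith, by linarith⟩
  have hμ' : -(Complex.I * V) - μ = -(Complex.I * s') := by rw [hμ, hV]; ring
  have r1 := h.ramInt_symm μ V a1 a2
  have r2 := h.ramInt_eq_invFT_mul (μ := μ) (V := V) (ξ₀ := ξ) (by linarith) (by linarith)
    (by linarith) a1 a2 hξ (by linarith)
  have r3 := h.ramInt_eq_invFT_mul (μ := -(Complex.I * s')) (V := V) (ξ := -η - V.im) (ξ₀ := ξ')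
    (by simpa using hs') (by simp; linarith) (by linarith) (abs_lt.2 ⟨by linarith, by linarith⟩)
    (abs_lt.2 ⟨by linarith, by linarith⟩) hξ' (by simpa using hsξ')
  rw [hμ', r2, r3, hI, hμ, hI, show V - s = s' by rw [hV]; ring,
    show V - s' = s by rw [hV]; ring, ← mul_assoc, ← mul_assoc, ← mul_assoc] at r1
  have r4 := mul_right_cancel₀ (h.ne_zero _) r1
  rw [show -(Complex.I * π * V ^ 2) - 2 * π * -(Complex.I * s) * V =
    -(Complex.I * π * s' ^ 2) + Complex.I * π * s ^ 2 by rw [hV]; ring, Complex.exp_add] at r4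
  have n1 := h.ne_zero (s - Complex.I * q)
  have n2 := h.ne_zero (s' - Complex.I * q)
  have hc : Complex.exp (Complex.I * π * s ^ 2) * Complex.exp (-(Complex.I * π * s ^ 2)) = 1 := by
    rw [← Complex.exp_add]; simp
  have r5 : invFT F ξ s * F (s - Complex.I * q) =
      Complex.exp (-(Complex.I * π * s' ^ 2)) * Complex.exp (Complex.I * π * s ^ 2) *
        invFT F ξ' s' * F (s' - Complex.I * q) := by
    calc _ = invFT F ξ s * (F (s' - Complex.I * q))⁻¹ * F (s' - Complex.I * q) *
          F (s - Complex.I * q) := by rw [inv_mul_cancel_right₀ n2]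
      _ = (Complex.exp (-(Complex.I * π * s' ^ 2)) * Complex.exp (Complex.I * π * s ^ 2) *
        invFT F ξ' s' * (F (s - Complex.I * q))⁻¹) * F (s' - Complex.I * q) *
          F (s - Complex.I * q) := by rw [r4]
      _ = Complex.exp (-(Complex.I * π * s' ^ 2)) * Complex.exp (Complex.I * π * s ^ 2) *
        invFT F ξ' s' * F (s' - Complex.I * q) *
          ((F (s - Complex.I * q))⁻¹ * F (s - Complex.I * q)) := by ring
      _ = _ := by rw [inv_mul_cancel₀ n1, mul_one]
  linear_combination Complex.exp (-(Complex.I * π * s ^ 2)) * r5 +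
    (Complex.exp (-(Complex.I * π * s' ^ 2)) * invFT F ξ' s' * F (s' - Complex.I * q)) * hc

/-- Abelian limit of the Fourier transform of `1 / F` at the origin. -/
lemma exists_tendsto_mul_invFT (h : IsQDilog b q F A) {η : ℝ} (hη : 0 < η) (hηq : η < q) :
    ∃ L : ℝ, L ≠ 0 ∧ Filter.Tendsto (fun ε : ℝ => ε * invFT F (-η) (Complex.I * ε))
      (nhdsWithin 0 (Set.Ioi 0)) (nhds (L : ℂ)) := by
  obtain ⟨C, hC0, hC⟩ := h.bound hηq
  have hbd : ∀ x : ℝ, ‖(F (x + (-η : ℝ) * Complex.I))⁻¹‖ ≤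
      C * Real.exp (-(2 * π * η) * max x 0) := by
    intro x
    have := (hC (x + (-η : ℝ) * Complex.I) (by simp [abs_of_pos hη])).2
    refine this.trans (le_of_eq ?_)
    congr 2
    simp; ring
  set g : ℝ → ℝ := Set.indicator (Set.Iic 0) fun T => Real.exp (2 * π * T) with hg
  refine ⟨∫ T, g T, ?_, ?_⟩
  · rw [hg, integral_indicator measurableSet_Iic, integral_exp_mul_Iic (by positivity)]
    positivity
  · have key : ∀ ε : ℝ, 0 < ε → ε * invFT F (-η) (Complex.I * ε) =
        ∫ T : ℝ, (F ((T / ε : ℝ) + (-η : ℝ) * Complex.I))⁻¹ *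
          Complex.exp (2 * π * (T + ε * (-η : ℝ) * Complex.I)) := by
      intro ε hε
      have hε' : (ε : ℂ) ≠ 0 := mod_cast hε.ne'
      have := Measure.integral_comp_div (fun x : ℝ => (F (x + (-η : ℝ) * Complex.I))⁻¹ *
        Complex.exp (-2 * π * Complex.I * (Complex.I * ε) * (x + (-η : ℝ) * Complex.I))) ε
      rw [abs_of_pos hε, Complex.real_smul] at this
      rw [invFT, ← this]
      congr 1 with T
      congr 2
      push_cast
      field_simp
      linear_combination (-(T - ε * η * Complex.I)) * Complex.I_sq
    rw [← integral_complex_ofReal]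
    refine (tendsto_integral_filter_of_dominated_convergence (μ := volume)
      (F := fun (ε T : ℝ) => (F ((T / ε : ℝ) + (-η : ℝ) * Complex.I))⁻¹ *
          Complex.exp (2 * π * (T + ε * (-η : ℝ) * Complex.I)))
      (f := fun T => (g T : ℂ)) (fun T => C * Real.exp (-(2 * π) * |T|)) ?_ ?_
      ((integrable_exp_neg_mul_abs (by positivity)).const_mul C) ?_).congr' ?_
    · filter_upwards [self_mem_nhdsWithin] with ε hε
      have c := (h.continuous_invFT_kernel 0 (ξ := -η) (by rwa [abs_neg, abs_of_pos hη])).comp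
        (continuous_id.div_const ε)
      simp only [Function.comp_def, id, mul_zero, zero_mul, Complex.exp_zero, mul_one] at c
      exact (c.mul (by fun_prop)).aestronglyMeasurable
    · have : ∀ᶠ ε in nhdsWithin (0 : ℝ) (Set.Ioi 0), ε < η / 2 :=
        nhdsWithin_le_nhds (eventually_lt_nhds (by linarith))
      filter_upwards [self_mem_nhdsWithin, this] with ε hε hε2
      have hε : 0 < ε := hε
      refine Filter.Eventually.of_forall fun T => ?_
      rw [norm_mul, Complex.norm_exp]
      refine (mul_le_mul_of_nonneg_right (hbd _) (Real.exp_pos _).le).trans ?_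
      rw [mul_assoc, ← Real.exp_add]
      refine mul_le_mul_of_nonneg_left (Real.exp_le_exp.2 ?_) hC0.le
      have e : (2 * (π : ℂ) * (T + ε * (-η : ℝ) * Complex.I)).re = 2 * π * T := by simp
      rw [e]
      rcases le_total T 0 with hT | hT
      · rw [max_eq_right (div_nonpos_of_nonpos_of_nonneg hT hε.le), abs_of_nonpos hT]
        linarith
      · rw [max_eq_left (by positivity), abs_of_nonneg hT]
        have : 2 * T ≤ η * (T / ε) := by
          rw [mul_div_assoc', le_div_iff₀ hε]; nlinarith
        nlinarith [Real.pi_pos]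
    · have hne : ∀ᵐ T : ℝ, T ≠ 0 := by simp [ae_iff]
      filter_upwards [hne] with T hT
      have hinv : Filter.Tendsto (fun ε : ℝ => ε⁻¹) (nhdsWithin 0 (Set.Ioi 0)) Filter.atTop :=
        tendsto_inv_nhdsGT_zero
      have hexp : Filter.Tendsto (fun ε : ℝ => Complex.exp (2 * π * (T + ε * (-η : ℝ) *
          Complex.I))) (nhdsWithin 0 (Set.Ioi 0)) (nhds (Complex.exp (2 * π * T))) := by
        have : Continuous fun ε : ℝ => Complex.exp (2 * π * (T + ε * (-η : ℝ) * Complex.I)) := by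
          fun_prop
        have := this.tendsto 0
        simp only [Complex.ofReal_zero, zero_mul, add_zero] at this
        exact this.mono_left nhdsWithin_le_nhds
      rcases lt_or_gt_of_ne hT with hT | hT
      · have t1 : Filter.Tendsto (fun ε : ℝ => T / ε) (nhdsWithin 0 (Set.Ioi 0)) Filter.atBot := by
          simp only [div_eq_mul_inv]
          exact hinv.const_mul_atTop_of_neg hT
        have t2 := (((h.tendsto_left (-η) (by rwa [abs_neg, abs_of_pos hη])).comp t1).inv₀
          one_ne_zero).mul hexp
        have : ((g T : ℝ) : ℂ) = 1⁻¹ * Complex.exp (2 * π * T) := by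
          rw [hg, Set.indicator_of_mem (Set.mem_Iic.2 hT.le)]; simp
        rw [this]
        exact t2
      · have t1 : Filter.Tendsto (fun ε : ℝ => T / ε) (nhdsWithin 0 (Set.Ioi 0)) Filter.atTop := by
          simp only [div_eq_mul_inv]
          exact hinv.const_mul_atTop hT
        have t3 : Filter.Tendsto (fun x : ℝ => C * Real.exp (-(2 * π * η) * max x 0)) Filter.atTop
            (nhds 0) := by
          have m : Filter.Tendsto (fun x : ℝ => max x 0) Filter.atTop Filter.atTop :=
            Filter.tendsto_atTop_mono (fun x => le_max_left x 0) Filter.tendsto_id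
          have := (Real.tendsto_exp_atBot.comp
            (m.const_mul_atTop_of_neg (r := -(2 * π * η)) (by
              have := mul_pos (mul_pos two_pos Real.pi_pos) hη; linarith))).const_mul C
          simpa using this
        have t2 : Filter.Tendsto (fun x : ℝ => (F (x + (-η : ℝ) * Complex.I))⁻¹) Filter.atTop
            (nhds 0) := squeeze_zero_norm hbd t3
        have t4 := (t2.comp t1).mul hexp
        have : ((g T : ℝ) : ℂ) = 0 * Complex.exp (2 * π * T) := by
          rw [hg, Set.indicator_of_notMem (by simpa using hT)]; simp
        rw [this]
        exact t4
    · filter_upwards [self_mem_nhdsWithin] with ε hε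
      exact (key ε hε).symm

/-- The Fourier transform of `1 / F` is, up to a Gaussian, a shift of `1 / F`. -/
lemma exists_invFT_eq (h : IsQDilog b q F A) : ∃ D : ℂ,
    D = conj D * A * Complex.exp (-(Complex.I * π * q ^ 2)) ∧
    ∀ (s : ℂ) (ξ : ℝ), 0 < s.im → -q < ξ → ξ < -s.im →
      invFT F ξ s = D * Complex.exp (Complex.I * π * s ^ 2) * (F (s - Complex.I * q))⁻¹ := by
  have hq := h.q_pos
  set η := q / 2 with hη
  set s₀ : ℂ := Complex.I * (η / 2 : ℝ) with hs₀
  set D := invFT F (-η) s₀ * Complex.exp (-(Complex.I * π * s₀ ^ 2)) * F (s₀ - Complex.I * q)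
    with hD
  have hs₀im : s₀.im = η / 2 := by simp [hs₀]
  have hDs : ∀ (s : ℂ) (ξ : ℝ), 0 < s.im → -q < ξ → ξ < -s.im →
      invFT F ξ s * Complex.exp (-(Complex.I * π * s ^ 2)) * F (s - Complex.I * q) = D :=
    fun s ξ h1 h2 h3 => h.invFT_mul_eq h1 h2 h3 (by linarith) (by linarith) (by linarith)
  refine ⟨D, ?_, fun s ξ h1 h2 h3 => ?_⟩
  · obtain ⟨L, hL, hlim⟩ := h.exists_tendsto_mul_invFT (η := η) (by linarith) (by linarith)
    have hrel : ∀ᶠ ε : ℝ in nhdsWithin 0 (Set.Ioi 0),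
        D * conj (ε * invFT F (-η) (Complex.I * ε)) * Complex.exp (-(Complex.I * π * ε ^ 2)) =
        (ε * invFT F (-η) (Complex.I * ε)) * Complex.exp (Complex.I * π * ε ^ 2) * A *
          Complex.exp (-(Complex.I * π * (q - ε) ^ 2)) * conj D := by
      have : ∀ᶠ ε in nhdsWithin (0 : ℝ) (Set.Ioi 0), ε < η :=
        nhdsWithin_le_nhds (eventually_lt_nhds (by linarith))
      filter_upwards [self_mem_nhdsWithin, this] with ε hε hε2
      have hε : 0 < ε := hε
      have d1 := hDs (Complex.I * ε) (-η) (by simpa using hε) (by linarith) (by simpa using hε2)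
      set w : ℂ := Complex.I * ε - Complex.I * q with hw
      have hwim : w.im = ε - q := by simp [hw]
      have r1 := h.inversion w (by linarith) (by linarith)
      have hcw : conj w = -w := by simp [hw]; ring
      have r2 := h.conj_eq w
      rw [hcw] at r2
      have r3 : F w = A * Complex.exp (Complex.I * π * w ^ 2) * conj (F w) := by
        rw [← r1, mul_assoc, r2, mul_one]
      rw [show Complex.I * π * w ^ 2 = -(Complex.I * π * (q - ε) ^ 2) by
        rw [hw]; linear_combination (Complex.I * π * (q - ε) ^ 2) * Complex.I_sq] at r3
      rw [show -(Complex.I * π * (Complex.I * ε) ^ 2) = Complex.I * π * ε ^ 2 by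
        linear_combination (-Complex.I * π * ε ^ 2) * Complex.I_sq] at d1
      have d2 := congrArg conj d1
      rw [map_mul, map_mul, ← Complex.exp_conj] at d2
      simp only [map_mul, map_pow, Complex.conj_I, Complex.conj_ofReal] at d2
      rw [show -Complex.I * π * (ε : ℂ) ^ 2 = -(Complex.I * π * ε ^ 2) by ring] at d2
      rw [map_mul, Complex.conj_ofReal]
      linear_combination
        (-(ε * conj (invFT F (-η) (Complex.I * ε)) * Complex.exp (-(Complex.I * π * ε ^ 2)))) * d1 +
        (ε * invFT F (-η) (Complex.I * ε) * Complex.exp (Complex.I * π * ε ^ 2) * A *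
          Complex.exp (-(Complex.I * π * (q - ε) ^ 2))) * d2 +
        (invFT F (-η) (Complex.I * ε) * Complex.exp (Complex.I * π * ε ^ 2) * ε *
          conj (invFT F (-η) (Complex.I * ε)) * Complex.exp (-(Complex.I * π * ε ^ 2))) * r3
    have hcont : ∀ f : ℝ → ℂ, Continuous f →
        Filter.Tendsto f (nhdsWithin 0 (Set.Ioi 0)) (nhds (f 0)) :=
      fun f hf => (hf.tendsto 0).mono_left nhdsWithin_le_nhds
    have t1 := ((((Complex.continuous_conj.tendsto _).comp hlim).const_mul D).mul
      (hcont (fun ε => Complex.exp (-(Complex.I * π * ε ^ 2))) (by fun_prop)))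
    have t2 := (((hlim.mul (hcont (fun ε => Complex.exp (Complex.I * π * ε ^ 2))
      (by fun_prop))).mul_const A).mul
      (hcont (fun ε => Complex.exp (-(Complex.I * π * (q - ε) ^ 2))) (by fun_prop))).mul_const
        (conj D)
    have e := tendsto_nhds_unique (t1.congr' hrel) t2
    have hL' : (L : ℂ) ≠ 0 := mod_cast hL
    simp only [Complex.conj_ofReal, Complex.ofReal_zero, sub_zero] at e
    norm_num at e
    apply mul_left_cancel₀ hL'
    linear_combination e
  · rw [← hDs s ξ h1 h2 h3]
    have hc : Complex.exp (-(Complex.I * π * s ^ 2)) * Complex.exp (Complex.I * π * s ^ 2) = 1 := by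
      rw [← Complex.exp_add]; simp
    calc _ = invFT F ξ s * (Complex.exp (-(Complex.I * π * s ^ 2)) *
          Complex.exp (Complex.I * π * s ^ 2)) *
          (F (s - Complex.I * q) * (F (s - Complex.I * q))⁻¹) := by
          rw [hc, mul_inv_cancel₀ (h.ne_zero _)]; ring
      _ = _ := by ring

/-- The Fourier transform of `F` expressed through that of `1 / F`. -/
lemma integral_mul_exp_eq_invFT (h : IsQDilog b q F A) {s : ℂ} {η : ℝ} (hs : 0 < s.im)
    (hsη : s.im < η) (hη : η < q) :
    ∫ x : ℝ, F (x + η * Complex.I) * Complex.exp (-2 * π * Complex.I * s * (x + η * Complex.I)) =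
      Complex.exp (2 * π * q * s - Complex.I * π * s ^ 2) * invFT F (-η) s := by
  obtain ⟨D, hD, hs'⟩ := h.exists_invFT_eq
  have hpt : ∀ x : ℝ, F (x + η * Complex.I) *
      Complex.exp (-2 * π * Complex.I * s * (x + η * Complex.I)) =
      conj ((F (x + (-η : ℝ) * Complex.I))⁻¹ *
        Complex.exp (-2 * π * Complex.I * (-conj s) * (x + (-η : ℝ) * Complex.I))) := by
    intro x
    have r := h.conj_eq (x + (-η : ℝ) * Complex.I)
    have hc : conj ((x : ℂ) + (-η : ℝ) * Complex.I) = x + η * Complex.I := by simp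
    rw [hc] at r
    rw [map_mul, map_inv₀, ← eq_inv_of_mul_eq_one_left r, ← Complex.exp_conj]
    congr 2
    simp [Complex.conj_ofNat]
  simp_rw [hpt]
  rw [integral_conj]
  change conj (invFT F (-η) (-conj s)) = _
  rw [hs' (-conj s) (-η) (by simpa using hs) (by linarith) (by simpa using hsη),
    hs' s (-η) hs (by linarith) (by linarith)]
  have r1 := h.conj_eq (-conj s - Complex.I * q)
  have hc : conj (-conj s - Complex.I * q) = -(s - Complex.I * q) := by simp; ring
  rw [hc] at r1
  have r2 := h.inversion (s - Complex.I * q) (by simp; linarith) (by simp; linarith)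
  rw [map_mul, map_mul, map_inv₀, ← eq_inv_of_mul_eq_one_left r1, ← Complex.exp_conj]
  have e1 : conj (Complex.I * π * (-conj s) ^ 2) = -(Complex.I * π * s ^ 2) := by simp
  have n := h.ne_zero (s - Complex.I * q)
  have r3 : F (-(s - Complex.I * q)) = A * Complex.exp (Complex.I * π * (s - Complex.I * q) ^ 2) *
      (F (s - Complex.I * q))⁻¹ := by
    rw [← r2, mul_comm (F (s - Complex.I * q)), mul_inv_cancel_right₀ n]
  have e2 : Complex.exp (-(Complex.I * π * s ^ 2)) *
      Complex.exp (Complex.I * π * (s - Complex.I * q) ^ 2) =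
      Complex.exp (-(Complex.I * π * q ^ 2)) *
        (Complex.exp (2 * π * q * s - Complex.I * π * s ^ 2) *
        Complex.exp (Complex.I * π * s ^ 2)) := by
    rw [← Complex.exp_add, ← Complex.exp_add, ← Complex.exp_add]
    congr 1
    linear_combination (Complex.I * π * q ^ 2 - 2 * π * q * s) * Complex.I_sq
  rw [e1, r3]
  linear_combination (conj D * A * (F (s - Complex.I * q))⁻¹) * e2 -
    (Complex.exp (2 * π * q * s - Complex.I * π * s ^ 2) * Complex.exp (Complex.I * π * s ^ 2) *
      (F (s - Complex.I * q))⁻¹) * hD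

end IsQDilog

/-- The Fourier transform on the real line in the normalisation used for `psiT`. -/
def lineFT (f : ℝ → ℂ) (s : ℝ) : ℂ := ∫ t : ℝ, f t * Complex.exp (-2 * π * Complex.I * s * t)

lemma norm_exp_neg_two_pi_I_mul (s t : ℝ) : ‖Complex.exp (-2 * π * Complex.I * s * t)‖ = 1 := by
  rw [Complex.norm_exp]; simp

lemma norm_exp_two_pi_I_mul (s t : ℝ) : ‖Complex.exp (2 * π * Complex.I * s * t)‖ = 1 := by
  rw [Complex.norm_exp]; simp

lemma integral_mul_lineFT {f H : ℝ → ℂ} (hf : Integrable f) (hH : Integrable H) (α : ℝ) :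
    Integrable (fun σ : ℝ => H σ * lineFT f (α - σ)) ∧
    ∫ σ : ℝ, H σ * lineFT f (α - σ) = ∫ x : ℝ, f x * Complex.exp (-2 * π * Complex.I * α * x) *
      ∫ σ : ℝ, H σ * Complex.exp (2 * π * Complex.I * σ * x) := by
  have hprod : Integrable (fun p : ℝ × ℝ => H p.1 * f p.2 *
      Complex.exp (-2 * π * Complex.I * (α - p.1 : ℝ) * p.2)) (volume.prod volume) :=
    (hH.mul_prod hf).mul_bdd (c := 1)
      (Continuous.aestronglyMeasurable (by fun_prop))
      (Filter.Eventually.of_forall fun p => (norm_exp_neg_two_pi_I_mul _ _).le)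
  have e : ∀ σ : ℝ, H σ * lineFT f (α - σ) = ∫ x : ℝ, H σ * f x *
      Complex.exp (-2 * π * Complex.I * (α - σ : ℝ) * x) := by
    intro σ
    rw [lineFT, ← integral_const_mul]
    congr 1 with x
    ring
  refine ⟨?_, ?_⟩
  · simp_rw [e]
    exact hprod.integral_prod_left
  · simp_rw [e]
    rw [integral_integral_swap (f := fun σ x : ℝ => H σ * f x *
      Complex.exp (-2 * π * Complex.I * (α - σ : ℝ) * x)) hprod]
    congr 1 with x
    rw [← integral_const_mul]
    congr 1 with σ
    rw [show -2 * π * Complex.I * ((α - σ : ℝ) : ℂ) * x = -2 * π * Complex.I * α * x +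
      2 * π * Complex.I * σ * x by push_cast; ring, Complex.exp_add]
    ring

lemma integral_lineFT_mul_exp {f : ℝ → ℂ} (hc : Continuous f) (hf : Integrable f)
    (h'f : Integrable (lineFT f)) (w : ℝ) :
    ∫ σ : ℝ, lineFT f σ * Complex.exp (2 * π * Complex.I * σ * w) = f w := by
  have e : FourierTransform.fourier f = lineFT f := by
    funext s
    rw [Real.fourier_real_eq_integral_exp_smul, lineFT]
    congr 1 with t
    rw [smul_eq_mul, mul_comm]
    congr 2
    push_cast
    ring
  have := congrFun (hc.fourierInv_fourier_eq hf (by rwa [e])) w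
  rw [e, Real.fourierInv_eq'] at this
  rw [← this]
  congr 1 with σ
  rw [smul_eq_mul, mul_comm]
  congr 2
  simp
  ring

/-- The function `ψ_{a,c}` on the real line, for a function `F` in place of `Φ_𝖻`. -/
def psiQ (F : ℂ → ℂ) (q a c : ℝ) (t : ℝ) : ℂ :=
  (F (t + (-(2 * q * (a + c)) : ℝ) * Complex.I))⁻¹ *
    Complex.exp (4 * π * q * a * (t - Complex.I * q * (a + c))) *
    Complex.exp (π * Complex.I * q ^ 2 * (4 * (a - c) + 1) / 6)

namespace IsQDilog

variable {b q : ℝ} {F : ℂ → ℂ} {A : ℂ}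

lemma integrable_invFT_kernel (h : IsQDilog b q F A) {s : ℂ} {ξ : ℝ} (h1 : -q < ξ)
    (hs : 0 < s.im) (h2 : ξ < -s.im) : Integrable fun x : ℝ => (F (x + ξ * Complex.I))⁻¹ *
      Complex.exp (-2 * π * Complex.I * s * (x + ξ * Complex.I)) := by
  obtain ⟨C, κ, hκ, hb⟩ := h.norm_invFT_kernel_le h1 hs h2
  refine integrable_of_norm_le_exp_neg_abs (h.continuous_invFT_kernel s
    (abs_lt.2 ⟨h1, by linarith [h.q_pos]⟩)) hκ (fun x => ?_) (C := C)
  simpa using hb (x + ξ * Complex.I) (by simp) (by simp)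

lemma psiQ_mul_exp (s : ℂ) (a c t : ℝ) :
    psiQ F q a c t * Complex.exp (-2 * π * Complex.I * s * t) =
      Complex.exp (π * Complex.I * q ^ 2 * (4 * (a - c) + 1) / 6 +
        4 * π * Complex.I * q ^ 2 * a * (a + c) + 4 * π * q * (a + c) * s) *
      ((F (t + (-(2 * q * (a + c)) : ℝ) * Complex.I))⁻¹ *
        Complex.exp (-2 * π * Complex.I * (s + 2 * q * a * Complex.I) *
          (t + (-(2 * q * (a + c)) : ℝ) * Complex.I))) := by
  rw [psiQ, mul_assoc, mul_assoc, ← Complex.exp_add, ← Complex.exp_add, mul_left_comm,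
    ← Complex.exp_add]
  congr 2
  push_cast
  linear_combination (-4 * π * q * (a + c) * s + 4 * π * q * a * t -
    8 * π * q ^ 2 * a * (a + c) * Complex.I) * Complex.I_sq

lemma integrable_psiQ (h : IsQDilog b q F A) {a c : ℝ} (ha : 0 < a) (hc : 0 < c)
    (hb : a + c < 1 / 2) : Integrable (psiQ F q a c) := by
  have hq := h.q_pos
  have := (h.integrable_invFT_kernel (s := 0 + 2 * q * a * Complex.I) (ξ := -(2 * q * (a + c)))
    (by nlinarith) (by simp; positivity) (by simp; nlinarith)).const_mul
    (Complex.exp (π * Complex.I * q ^ 2 * (4 * (a - c) + 1) / 6 +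
        4 * π * Complex.I * q ^ 2 * a * (a + c) + 4 * π * q * (a + c) * 0))
  refine this.congr (Filter.Eventually.of_forall fun t => ?_)
  simp only
  rw [← psiQ_mul_exp]
  simp

lemma lineFT_psiQ (a c s : ℝ) :
    lineFT (psiQ F q a c) s = Complex.exp (π * Complex.I * q ^ 2 * (4 * (a - c) + 1) / 6 +
        4 * π * Complex.I * q ^ 2 * a * (a + c) + 4 * π * q * (a + c) * s) *
      invFT F (-(2 * q * (a + c))) (s + 2 * q * a * Complex.I) := by
  rw [lineFT, invFT, ← integral_const_mul]
  congr 1 with t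
  exact psiQ_mul_exp s a c t

/-- The function whose Fourier transform is the Gaussian modification of that of `psiQ`. -/
def _root_.psiDual (F : ℂ → ℂ) (q a c : ℝ) (w : ℝ) : ℂ :=
  Complex.exp (π * Complex.I * q ^ 2 * (4 * (a - c) + 1) / 6 - 4 * π * Complex.I * q ^ 2 * a * c) *
    (F (w + (q * (1 - 2 * c) : ℝ) * Complex.I) * Complex.exp (4 * π * q * a * w))

lemma lineFT_psiDual (h : IsQDilog b q F A) {a c : ℝ} (ha : 0 < a) (hc : 0 < c)
    (hb : a + c < 1 / 2) (s : ℝ) : lineFT (psiDual F q a c) s =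
      Complex.exp (-π * Complex.I * s ^ 2) * lineFT (psiQ F q a c) s := by
  have hq := h.q_pos
  have k := h.integral_mul_exp_eq_invFT (s := s + 2 * q * a * Complex.I) (η := q * (1 - 2 * c))
    (by simp; positivity) (by simp; nlinarith) (by nlinarith)
  rw [lineFT_psiQ, h.invFT_eq (y₂ := -(q * (1 - 2 * c))) (by simp; positivity) (by nlinarith)
    (by simp; nlinarith) (by nlinarith) (by simp; nlinarith)]
  have n := Complex.exp_ne_zero (2 * π * q * (s + 2 * q * a * Complex.I) -
    Complex.I * π * (s + 2 * q * a * Complex.I) ^ 2)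
  have k' : invFT F (-(q * (1 - 2 * c))) (s + 2 * q * a * Complex.I) =
      Complex.exp (-(2 * π * q * (s + 2 * q * a * Complex.I) -
    Complex.I * π * (s + 2 * q * a * Complex.I) ^ 2)) * ∫ x : ℝ, F (x + (q * (1 - 2 * c) : ℝ) *
      Complex.I) * Complex.exp (-2 * π * Complex.I * (s + 2 * q * a * Complex.I) *
        (x + (q * (1 - 2 * c) : ℝ) * Complex.I)) := by
    rw [k, Complex.exp_neg, inv_mul_cancel_left₀ n]
  rw [k', ← mul_assoc, ← mul_assoc, ← Complex.exp_add, ← Complex.exp_add, lineFT,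
    ← integral_const_mul]
  congr 1 with x
  have regroup : ∀ e f g k : ℂ, e * (f * g) * k = f * (e * g * k) := by intros; ring
  rw [psiDual, regroup, mul_left_comm (Complex.exp _) (F _), ← Complex.exp_add,
    ← Complex.exp_add, ← Complex.exp_add]
  congr 2
  push_cast
  linear_combination -(4 * π * s * q * a + 4 * π * Complex.I * q ^ 2 * a ^ 2 -
    2 * π * s * q * (1 - 2 * c) - 4 * π * q * a * x -
    4 * π * q ^ 2 * a * (1 - 2 * c) * Complex.I) * Complex.I_sq

lemma continuous_psiDual (h : IsQDilog b q F A) (a : ℝ) {c : ℝ} (hc : 0 < c) (hc1 : c < 1) :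
    Continuous (psiDual F q a c) := by
  have hq := h.q_pos
  have hF : Continuous fun w : ℝ => F (w + (q * (1 - 2 * c) : ℝ) * Complex.I) := by
    refine continuous_iff_continuousAt.2 fun w => ContinuousAt.comp (g := F)
      (h.differentiableAt ?_ ?_).continuousAt (by fun_prop)
    · simp; nlinarith
    · simp; nlinarith
  exact continuous_const.mul (hF.mul (by fun_prop))

lemma integrable_psiDual (h : IsQDilog b q F A) {a c : ℝ} (ha : 0 < a) (hc : 0 < c)
    (hb : a + c < 1 / 2) : Integrable (psiDual F q a c) := by
  have hq := h.q_pos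
  have k := h.integrable_invFT_kernel (s := 2 * q * a * Complex.I) (ξ := -(q * (1 - 2 * c)))
    (by nlinarith) (by simp; positivity) (by simp; nlinarith)
  refine Integrable.mono (k.const_mul (Complex.exp (π * Complex.I * q ^ 2 * (4 * (a - c) + 1) / 6 -
    4 * π * Complex.I * q ^ 2 * a * c)))
    (h.continuous_psiDual a hc (by linarith)).aestronglyMeasurable
    (Filter.Eventually.of_forall fun x => le_of_eq ?_)
  have e := h.conj_eq (x + (-(q * (1 - 2 * c)) : ℝ) * Complex.I)
  rw [show conj ((x : ℂ) + (-(q * (1 - 2 * c)) : ℝ) * Complex.I) =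
    x + (q * (1 - 2 * c) : ℝ) * Complex.I by
      rw [map_add, map_mul, Complex.conj_ofReal, Complex.conj_ofReal, Complex.conj_I]
      push_cast
      ring] at e
  have e' := congrArg norm (eq_inv_of_mul_eq_one_left e)
  rw [norm_inv, RCLike.norm_conj] at e'
  rw [psiDual, norm_mul, norm_mul, norm_mul, norm_mul, norm_inv, e', Complex.norm_exp (_ * (x : ℂ)),
    Complex.norm_exp (_ * (_ + _))]
  congr 3
  simp
  ring_nf
  simp

lemma integrable_lineFT_psiDual (h : IsQDilog b q F A) {a c : ℝ} (ha : 0 < a) (hc : 0 < c)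
    (hb : a + c < 1 / 2) : Integrable (lineFT (psiDual F q a c)) := by
  have hq := h.q_pos
  obtain ⟨D, -, hD⟩ := h.exists_invFT_eq
  have k := (h.integrable_invFT_kernel (s := 2 * q * c * Complex.I) (ξ := -(q * (1 - 2 * a)))
    (by nlinarith) (by simp; positivity) (by simp; nlinarith)).const_mul
    (D * Complex.exp (π * Complex.I * q ^ 2 * (4 * (a - c) + 1) / 6 +
        4 * π * Complex.I * q ^ 2 * a * c + 4 * π * Complex.I * q ^ 2 * c * (1 - 2 * a)))
  refine k.congr (Filter.Eventually.of_forall fun s => ?_)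
  simp only
  rw [h.lineFT_psiDual ha hc hb, lineFT_psiQ, hD _ _ (by simp; positivity) (by nlinarith)
    (by simp; nlinarith)]
  have r1 : ∀ d e f g : ℂ, d * e * (f * g) = d * f * (e * g) := by intros; ring
  have r2 : ∀ d e f g k : ℂ, e * (f * (d * g * k)) = d * k * (e * (f * g)) := by intros; ring
  rw [r1, r2, ← Complex.exp_add, ← Complex.exp_add, ← Complex.exp_add,
    show (s : ℂ) + 2 * q * a * Complex.I - Complex.I * q =
      s + (-(q * (1 - 2 * a)) : ℝ) * Complex.I by push_cast; ring]
  congr 2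
  push_cast
  linear_combination (-4 * π * s * q * c - 4 * π * s * q * a +
    4 * π * q ^ 2 * c * (1 - 2 * a) * Complex.I - 4 * π * q ^ 2 * a ^ 2 * Complex.I) * Complex.I_sq

lemma psiQ_mul_psiDual_eq_ramKer (q a₀ c₀ a₂ c₂ α v x : ℝ) :
    psiQ F q a₀ c₀ x * Complex.exp (-2 * π * Complex.I * α * x) * psiDual F q a₂ c₂ (v + x) =
      Complex.exp (π * Complex.I * q ^ 2 * (4 * (a₀ - c₀) + 1) / 6 +
        π * Complex.I * q ^ 2 * (4 * (a₂ - c₂) + 1) / 6 - 4 * π * Complex.I * q ^ 2 * a₂ * c₂ -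
        4 * π * Complex.I * q ^ 2 * a₀ * (a₀ + c₀) + 4 * π * q * a₂ * v +
        4 * π * q * (a₀ + c₀) * Complex.I * (2 * q * (a₀ + a₂) - Complex.I * α)) *
      ramKer F (2 * q * (a₀ + a₂) - Complex.I * α)
        (v + (q * (1 - 2 * c₂) + 2 * q * (a₀ + c₀) : ℝ) * Complex.I)
        (x + (-(2 * q * (a₀ + c₀)) : ℝ) * Complex.I) := by
  have r1 : ∀ f e₁ e₂ e₃ e₄ g e₅ : ℂ, f * e₁ * e₂ * e₃ * (e₄ * (g * e₅)) =
      f * g * (e₁ * (e₂ * (e₃ * (e₄ * e₅)))) := by intros; ring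
  rw [psiQ, psiDual, ramKer, r1, mul_left_comm (Complex.exp _) (_ * _), ← Complex.exp_add,
    ← Complex.exp_add, ← Complex.exp_add, ← Complex.exp_add, ← Complex.exp_add,
    show (x : ℂ) + (-(2 * q * (a₀ + c₀)) : ℝ) * Complex.I +
      (v + (q * (1 - 2 * c₂) + 2 * q * (a₀ + c₀) : ℝ) * Complex.I) =
      (v + x : ℝ) + (q * (1 - 2 * c₂) : ℝ) * Complex.I by push_cast; ring]
  congr 2
  push_cast
  ring

/-- Ramanujan's integral, rewritten for the functions `ψ_{a,c}`. -/
lemma psiQ_mul_integral_psiDual (h : IsQDilog b q F A) {a₀ a₂ a₄ c₀ c₄ : ℝ} (ha₀ : 0 < a₀)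
    (ha₂ : 0 < a₂) (ha₄ : 0 < a₄) (hc₀ : 0 < c₀) (hc₄ : 0 < c₄)
    (h1 : a₀ + a₂ + (c₀ + a₄) < 1 / 2) (h2 : a₂ + (c₀ + a₄ + (a₀ + c₄)) < 1 / 2)
    (h3 : a₂ + a₄ + (a₀ + c₄) < 1 / 2) (α v : ℝ) :
    psiQ F q a₄ c₄ v * ∫ x : ℝ, psiQ F q a₀ c₀ x * Complex.exp (-2 * π * Complex.I * α * x) *
        psiDual F q a₂ (c₀ + a₄ + (a₀ + c₄)) (v + x) =
      Complex.exp (-π * Complex.I * (2 * (c₀ + a₂ + c₄) - 1 / 2) * q ^ 2 / 3) *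
        lineFT (psiQ F q (a₀ + a₂) (c₀ + a₄)) α *
        psiQ F q (a₂ + a₄) (a₀ + c₄) (v - α) := by
  have hq := h.q_pos
  simp_rw [psiQ_mul_psiDual_eq_ramKer]
  rw [integral_const_mul, ← ramInt,
    h.ramInt_eq_invFT_mul (ξ₀ := -(2 * q * ((a₀ + a₂ : ℝ) + (c₀ + a₄ : ℝ))))
    (by simp; positivity) (by simp; nlinarith) (by simp; nlinarith)
    (abs_lt.2 ⟨by nlinarith, by nlinarith⟩)
    (abs_lt.2 ⟨by simp; nlinarith, by simp; nlinarith⟩)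
    (by nlinarith) (by simp; nlinarith), lineFT_psiQ, psiQ, psiQ]
  have hF := h.ne_zero ((v : ℂ) + (-(2 * q * (a₄ + c₄)) : ℝ) * Complex.I)
  rw [show (v : ℂ) + (q * (1 - 2 * (c₀ + a₄ + (a₀ + c₄))) + 2 * q * (a₀ + c₀) : ℝ) * Complex.I -
      Complex.I * q = v + (-(2 * q * (a₄ + c₄)) : ℝ) * Complex.I by push_cast; ring,
    show (v : ℂ) + (q * (1 - 2 * (c₀ + a₄ + (a₀ + c₄))) + 2 * q * (a₀ + c₀) : ℝ) * Complex.I -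
      Complex.I * (2 * q * (a₀ + a₂) - Complex.I * α) - Complex.I * q =
      (v - α : ℝ) + (-(2 * q * (a₂ + a₄ + (a₀ + c₄))) : ℝ) * Complex.I by
      push_cast
      linear_combination (α : ℂ) * Complex.I_sq,
    show Complex.I * (2 * q * (a₀ + a₂) - Complex.I * α) =
      α + 2 * q * (a₀ + a₂ : ℝ) * Complex.I by
      push_cast
      linear_combination -(α : ℂ) * Complex.I_sq]
  have r1 : ∀ f e₁ e₂ e₃ g k : ℂ, f ≠ 0 → f⁻¹ * e₁ * e₂ * (e₃ * (g * (k * f))) =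
      g * k * (e₁ * (e₂ * e₃)) := by
    intro f e₁ e₂ e₃ g k hf
    field_simp
  have r2 : ∀ e₁ e₂ e₃ e₄ g k : ℂ, e₁ * (e₂ * g) * (k * e₃ * e₄) =
      g * k * (e₁ * (e₂ * (e₃ * e₄))) := by intros; ring
  rw [r1 _ _ _ _ _ _ hF, r2, ← Complex.exp_add, ← Complex.exp_add, ← Complex.exp_add,
    ← Complex.exp_add, ← Complex.exp_add]
  congr 2
  push_cast
  linear_combination (-4 * π * q * (a₀ + c₀) * α) * Complex.I_sq

/-- The Fourier-transformed pentagon identity for a quantum dilogarithm `F`. -/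
theorem pentagon (h : IsQDilog b q F A) {a₀ a₂ a₄ c₀ c₄ : ℝ} (ha₀ : 0 < a₀)
    (ha₂ : 0 < a₂) (ha₄ : 0 < a₄) (hc₀ : 0 < c₀) (hc₄ : 0 < c₄)
    (h1 : a₀ + a₂ + (c₀ + a₄) < 1 / 2) (h2 : a₂ + (c₀ + a₄ + (a₀ + c₄)) < 1 / 2)
    (h3 : a₂ + a₄ + (a₀ + c₄) < 1 / 2) (α γ : ℝ) :
    Integrable (fun σ : ℝ => lineFT (psiDual F q a₂ (c₀ + a₄ + (a₀ + c₄))) σ *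
      lineFT (psiQ F q a₀ c₀) (α - σ) * lineFT (psiQ F q a₄ c₄) (γ - σ)) ∧
    ∫ σ : ℝ, lineFT (psiDual F q a₂ (c₀ + a₄ + (a₀ + c₄))) σ *
      lineFT (psiQ F q a₀ c₀) (α - σ) * lineFT (psiQ F q a₄ c₄) (γ - σ) =
      Complex.exp (-π * Complex.I * (2 * (c₀ + a₂ + c₄) - 1 / 2) * q ^ 2 / 3 -
          2 * π * Complex.I * α * γ) *
        lineFT (psiQ F q (a₀ + a₂) (c₀ + a₄)) α * lineFT (psiQ F q (a₂ + a₄) (a₀ + c₄)) γ := by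
  set c₂ := c₀ + a₄ + (a₀ + c₄) with hc₂
  have i0 := h.integrable_psiQ ha₀ hc₀ (by linarith)
  have i4 := h.integrable_psiQ ha₄ hc₄ (by linarith)
  have iD := h.integrable_lineFT_psiDual (c := c₂) ha₂ (by linarith) h2
  have inv := integral_lineFT_mul_exp (h.continuous_psiDual a₂ (c := c₂) (by linarith)
    (by linarith)) (h.integrable_psiDual ha₂ (by linarith) h2) iD
  obtain ⟨j, -⟩ := integral_mul_lineFT i0 iD α
  obtain ⟨k, e⟩ := integral_mul_lineFT i4 j γ
  refine ⟨k, e.trans ?_⟩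
  have inner : ∀ v : ℝ, ∫ σ : ℝ, lineFT (psiDual F q a₂ c₂) σ * lineFT (psiQ F q a₀ c₀) (α - σ) *
      Complex.exp (2 * π * Complex.I * σ * v) = ∫ x : ℝ, psiQ F q a₀ c₀ x *
        Complex.exp (-2 * π * Complex.I * α * x) * psiDual F q a₂ c₂ (v + x) := by
    intro v
    have iDv : Integrable fun σ : ℝ => lineFT (psiDual F q a₂ c₂) σ *
        Complex.exp (2 * π * Complex.I * σ * v) :=
      iD.mul_bdd (c := 1) (Continuous.aestronglyMeasurable (by fun_prop))
        (Filter.Eventually.of_forall fun σ => (norm_exp_two_pi_I_mul _ _).le)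
    simp_rw [mul_right_comm _ (lineFT (psiQ F q a₀ c₀) _)]
    rw [(integral_mul_lineFT i0 iDv α).2]
    congr 1 with x
    rw [← inv]
    congr 2 with σ
    rw [mul_assoc, ← Complex.exp_add]
    congr 2
    push_cast
    ring
  simp_rw [inner, mul_right_comm _ (Complex.exp (-2 * π * Complex.I * γ * _)),
    hc₂, h.psiQ_mul_integral_psiDual ha₀ ha₂ ha₄ hc₀ hc₄ h1 h2 h3]
  generalize lineFT (psiQ F q (a₀ + a₂) (c₀ + a₄)) α = L
  rw [← integral_sub_right_eq_self (fun v : ℝ => _ ) (-α)]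
  simp_rw [sub_neg_eq_add, add_sub_cancel_right]
  rw [Complex.exp_sub, lineFT, ← integral_const_mul]
  congr 1 with v
  rw [show -2 * π * Complex.I * γ * ((v + α : ℝ) : ℂ) = -2 * π * Complex.I * γ * v -
    2 * π * Complex.I * α * γ by push_cast; ring, Complex.exp_sub]
  ring

end IsQDilog

lemma exists_isQDilog_PhiS {bb : ℝ} (hbb : 0 < bb) :
    ∃ b A, IsQDilog b ((bb + bb⁻¹) / 2) (PhiS bb) A := by
  rcases le_total bb 1 with h1 | h1
  · exact ⟨_, _, isQDilog_PhiS hbb h1⟩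
  · have k := isQDilog_PhiS (inv_pos.2 hbb) (inv_le_one_of_one_le₀ h1)
    rw [PhiS_inv, inv_inv, add_comm] at k
    exact ⟨_, _, k⟩

lemma psiF_eq_psiQ {bb a c : ℝ} (hbb : 0 < bb) (ha : 0 < a) (hc : 0 < c) (hb : a + c < 1 / 2)
    (t : ℝ) : psiF bb a c t = psiQ (PhiS bb) ((bb + bb⁻¹) / 2) a c t := by
  have hq : 0 < (bb + bb⁻¹) / 2 := by positivity
  have hcB : cB bb = Complex.I * ((bb + bb⁻¹) / 2 : ℝ) := by
    rw [cB]
    push_cast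
    ring
  have harg : (t : ℂ) - 2 * cB bb * (a + c) =
      t + (-(2 * ((bb + bb⁻¹) / 2) * (a + c)) : ℝ) * Complex.I := by
    rw [hcB]
    push_cast
    ring
  rw [psiF, harg, Phi, if_neg (by simp; nlinarith), if_neg (by simp; nlinarith), psiQ, hcB]
  generalize (bb + bb⁻¹) / 2 = q
  congr 2
  · congr 1
    linear_combination (-4 * π * q * a * (t - Complex.I * q * (a + c))) * Complex.I_sq
  · linear_combination (-π * Complex.I * q ^ 2 * (4 * (a - c) + 1) / 6) * Complex.I_sq

lemma psiT_eq_lineFT {bb a c : ℝ} (hbb : 0 < bb) (ha : 0 < a) (hc : 0 < c) (hb : a + c < 1 / 2)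
    (s : ℝ) : psiT bb a c s = lineFT (psiQ (PhiS bb) ((bb + bb⁻¹) / 2) a c) s := by
  rw [psiT, lineFT]
  simp_rw [psiF_eq_psiQ hbb ha hc hb]

/-- Fourier-transformed form of the pentagon identity (eq. (13) of the paper),
including absolute convergence of the integral. -/
theorem pentagon_identity_fourier
    (bb : ℝ) (hbb : 0 < bb)
    (a0 a1 a2 a3 a4 c0 c1 c2 c3 c4 : ℝ)
    (ha0 : 0 < a0) (ha1 : 0 < a1) (ha2 : 0 < a2) (ha3 : 0 < a3) (ha4 : 0 < a4)
    (hc0 : 0 < c0) (hc1 : 0 < c1) (hc2 : 0 < c2) (hc3 : 0 < c3) (hc4 : 0 < c4)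
    (hb0 : 0 < 1 / 2 - a0 - c0) (hb1 : 0 < 1 / 2 - a1 - c1) (hb2 : 0 < 1 / 2 - a2 - c2)
    (hb3 : 0 < 1 / 2 - a3 - c3) (hb4 : 0 < 1 / 2 - a4 - c4)
    (e1 : a1 = a0 + a2) (e2 : a3 = a2 + a4) (e3 : c1 = c0 + a4)
    (e4 : c3 = a0 + c4) (e5 : c2 = c1 + c3)
    (α γ : ℝ) :
    Integrable (fun σ : ℝ =>
        psiT bb a4 c4 (γ - σ) * psiT' bb a2 c2 σ * psiT bb a0 c0 (α - σ)) ∧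
    (∫ σ : ℝ, psiT bb a4 c4 (γ - σ) * psiT' bb a2 c2 σ * psiT bb a0 c0 (α - σ)) =
      Complex.exp (-π * Complex.I * (2 * (c0 + a2 + c4) - 1 / 2) /
            (12 * ((((bb + bb⁻¹) ^ 2)⁻¹ : ℝ) : ℂ)) -
          2 * π * Complex.I * α * γ) *
        psiT bb a1 c1 α * psiT bb a3 c3 γ := by
  obtain ⟨b, A, h⟩ := exists_isQDilog_PhiS hbb
  have key : ∀ σ : ℝ, psiT bb a4 c4 (γ - σ) * psiT' bb a2 c2 σ * psiT bb a0 c0 (α - σ) =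
      lineFT (psiDual (PhiS bb) ((bb + bb⁻¹) / 2) a2 c2) σ *
        lineFT (psiQ (PhiS bb) ((bb + bb⁻¹) / 2) a0 c0) (α - σ) *
        lineFT (psiQ (PhiS bb) ((bb + bb⁻¹) / 2) a4 c4) (γ - σ) := by
    intro σ
    rw [h.lineFT_psiDual ha2 hc2 (by linarith), psiT', psiT_eq_lineFT hbb ha4 hc4 (by linarith),
      psiT_eq_lineFT hbb ha2 hc2 (by linarith), psiT_eq_lineFT hbb ha0 hc0 (by linarith)]
    ring
  simp_rw [key, psiT_eq_lineFT hbb ha1 hc1 (by linarith : a1 + c1 < 1 / 2),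
    psiT_eq_lineFT hbb ha3 hc3 (by linarith : a3 + c3 < 1 / 2)]
  subst e1 e2 e3 e4 e5
  obtain ⟨i, e⟩ := h.pentagon ha0 ha2 ha4 hc0 hc4 (by linarith) (by linarith) (by linarith) α γ
  refine ⟨i, e.trans ?_⟩
  congr 4
  push_cast
  rw [div_mul_eq_div_div, div_inv_eq_mul]
  ring
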